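/- arXiv:2101.03573 — 2 statements merged into one kernel-verified Lean document; each statement's English description precedes it below -/
import Mathlib

section
/- Let Q = (J,σ,ξ) be a Q-datum and 𝐢 a reduced word of w₀ adapted to Q. Then for every β ∈ Σ_ι ℤ_{≥0}α_ι, the map Ω_Q restricts to an isomorphism of posets from (KP(β), ≼_𝐢) onto (𝒫⁺_{Q,β}, ≤): it is a bijection from KP(β) to 𝒫⁺_{Q,β}, and for 𝐦,𝐧 ∈ KP(β) one has 𝐦 ≼_𝐢 𝐧 if and only if Ω_Q(𝐦) ≤ Ω_Q(𝐧). -/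
open scoped BigOperators Classical

namespace QDatumPaper

structure CartanADE (J : Type) [Fintype J] [DecidableEq J] where
  a : J → J → ℤ
  symm : ∀ ι j : J, a ι j = a j ι
  diag : ∀ ι : J, a ι ι = 2
  offDiag : ∀ ι j : J, ι ≠ j → a ι j = 0 ∨ a ι j = -1
  posDef : ∀ v : J → ℚ, v ≠ 0 → 0 < ∑ ι : J, ∑ j : J, v ι * (a ι j : ℚ) * v j
  indec : ∀ s : Set J, s.Nonempty →
    (∀ ι ∈ s, ∀ j : J, a ι j = -1 → j ∈ s) → s = Set.univ

variable {J : Type} [Fintype J] [DecidableEq J]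

/-- `j` lies in the `σ`-orbit of `ι`. -/
def SameOrbit (σ : Equiv.Perm J) (ι j : J) : Prop := ∃ k : ℕ, (σ ^ k) ι = j

/-- The size `𝗌_{\barι}` of the `σ`-orbit of `ι`. -/
noncomputable def orbitSize (σ : Equiv.Perm J) (ι : J) : ℕ :=
  ((Finset.range (orderOf σ)).image fun k => (σ ^ k) ι).card

/-- A diagram automorphism of the Cartan matrix `C`: no two distinct vertices in a common
orbit are adjacent. -/
structure DiagAut (C : CartanADE J) where
  σ : Equiv.Perm J
  compat : ∀ ι j : J, C.a (σ ι) (σ j) = C.a ι j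
  noAdj : ∀ (ι : J) (k : ℕ), (σ ^ k) ι ≠ ι → C.a ι ((σ ^ k) ι) ≠ -1

/-- Height function on `(J, σ)`. -/
def IsHeightFunction (C : CartanADE J) (D : DiagAut C) (ξ : J → ℤ) : Prop :=
  (∀ ι j : J, C.a ι j = -1 → orbitSize D.σ ι = orbitSize D.σ j →
      |ξ ι - ξ j| = (orbitSize D.σ ι : ℤ)) ∧
  (∀ ι j : J, C.a ι j = -1 → orbitSize D.σ ι < orbitSize D.σ j →
      ∃! j0 : J, SameOrbit D.σ j j0 ∧ |ξ ι - ξ j0| = 1 ∧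
        ∀ k : ℕ, k < orderOf D.σ → ξ ((D.σ ^ k) j0) = ξ j0 - 2 * (k : ℤ))

/-- Symmetric bilinear form on the root lattice `ℤ^J`. -/
def pairing (C : CartanADE J) (v w : J → ℤ) : ℤ := ∑ ι : J, ∑ j : J, v ι * C.a ι j * w j

/-- Positive roots. -/
def posRoots (C : CartanADE J) : Set (J → ℤ) :=
  {v | (∀ ι : J, 0 ≤ v ι) ∧ v ≠ 0 ∧ pairing C v v = 2}

def simpleRoot (ι : J) : J → ℤ := fun j => if j = ι then 1 else 0

/-- Simple reflection `s_ι` on the root lattice. -/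
def reflS (C : CartanADE J) (ι : J) (v : J → ℤ) : J → ℤ :=
  fun j => v j - (∑ κ : J, v κ * C.a κ ι) * simpleRoot ι j

/-- `applyRefls C [ι₁, …, ι_m] v = s_{ι₁}(s_{ι₂}(⋯ s_{ι_m}(v)⋯))`. -/
def applyRefls (C : CartanADE J) (w : List J) (v : J → ℤ) : J → ℤ :=
  w.foldr (reflS C) v

/-- `β_k = s_{ι₁} ⋯ s_{ι_{k-1}} (α_{ι_k})`. -/
def betaOf (C : CartanADE J) {L : ℕ} (ii : Fin L → J) (k : Fin L) : J → ℤ :=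
  applyRefls C ((List.ofFn ii).take k.1) (simpleRoot (ii k))

/-- `ii` is a reduced word of the longest element. -/
def IsReducedWord (C : CartanADE J) {L : ℕ} (ii : Fin L → J) : Prop :=
  L = (posRoots C).ncard ∧ Function.Injective (betaOf C ii) ∧
    ∀ k : Fin L, betaOf C ii k ∈ posRoots C

def pairingQ (C : CartanADE J) (v w : J → ℚ) : ℚ :=
  ∑ ι : J, ∑ j : J, v ι * (C.a ι j : ℚ) * w j

def reflQ (C : CartanADE J) (ι : J) (v : J → ℚ) : J → ℚ :=
  fun j => v j - (∑ κ : J, v κ * (C.a κ ι : ℚ)) * (if j = ι then 1 else 0)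

def applyReflsQ (C : CartanADE J) (w : List J) (v : J → ℚ) : J → ℚ :=
  w.foldr (reflQ C) v

/-- `Λ` is a system of fundamental weights: `(Λ_ι, α_j) = δ_{ιj}`. -/
def IsFundWeights (C : CartanADE J) (Λ : J → J → ℚ) : Prop :=
  ∀ ι j : J, pairingQ C (Λ ι) (fun κ => (simpleRoot j κ : ℚ)) = if ι = j then 1 else 0

/-- `ν_k = -(s_{ι₁} ⋯ s_{ι_k})(Λ_{ι_k})`. -/
def nuOf (C : CartanADE J) {L : ℕ} (ii : Fin L → J) (Λ : J → J → ℚ) (k : Fin L) : J → ℚ :=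
  - applyReflsQ C ((List.ofFn ii).take (k.1 + 1)) (Λ (ii k))

def betaQ (C : CartanADE J) {L : ℕ} (ii : Fin L → J) (k : Fin L) : J → ℚ :=
  fun j => (betaOf C ii k j : ℚ)

/-- The pairing `(ν_k, β_t)`. -/
def nuBetaPair (C : CartanADE J) {L : ℕ} (ii : Fin L → J) (Λ : J → J → ℚ) (k t : Fin L) : ℚ :=
  pairingQ C (nuOf C ii Λ k) (betaQ C ii t)

/-- `m` is a Kostant partition of `β`. -/
def IsKP (C : CartanADE J) (β : J → ℤ) (m : (J → ℤ) → ℤ) : Prop :=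
  (∀ v : J → ℤ, v ∉ posRoots C → m v = 0) ∧ (∀ v ∈ posRoots C, 0 ≤ m v) ∧
    ∑ᶠ v ∈ posRoots C, m v • v = β

/-- `ρ^ii(m)_r = Σ_{t ≤ r} m(β_t)(ν_r, β_t)`. -/
def rhoOf (C : CartanADE J) {L : ℕ} (ii : Fin L → J) (Λ : J → J → ℚ)
    (m : (J → ℤ) → ℤ) (r : Fin L) : ℚ :=
  ∑ t ∈ Finset.univ.filter (fun t : Fin L => t ≤ r),
    (m (betaOf C ii t) : ℚ) * nuBetaPair C ii Λ r t

/-- The partial order `≼_ii` on Kostant partitions. -/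
def kpLE (C : CartanADE J) {L : ℕ} (ii : Fin L → J) (Λ : J → J → ℚ)
    (m n : (J → ℤ) → ℤ) : Prop :=
  ∀ r : Fin L, rhoOf C ii Λ m r ≤ rhoOf C ii Λ n r

/-- The height function obtained from `ξ` by applying sources `w = [ι₁, …, ι_k]`. -/
noncomputable def heightAfter (σ : Equiv.Perm J) (ξ : J → ℤ) (w : List J) : J → ℤ :=
  w.foldl (fun η ι => fun j => η j - if j = ι then 2 * (orbitSize σ ι : ℤ) else 0) ξ

def IsSource (C : CartanADE J) (ξ : J → ℤ) (ι : J) : Prop :=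
  ∀ j : J, C.a ι j = -1 → ξ j < ξ ι

/-- `ii` is adapted to the Q-datum `(J, σ, ξ)`. -/
def IsAdapted (C : CartanADE J) (D : DiagAut C) (ξ : J → ℤ) {L : ℕ} (ii : Fin L → J) : Prop :=
  ∀ k : Fin L, IsSource C (heightAfter D.σ ξ ((List.ofFn ii).take k.1)) (ii k)

/-- `(s_{ι_{k-1}} ⋯ s_{ι_1} ξ)_{ι_k}`, the second component of `Ω̃_Q(β_k)`. -/
noncomputable def heightAt (σ : Equiv.Perm J) (ξ : J → ℤ) {L : ℕ} (ii : Fin L → J) (k : Fin L) : ℤ :=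
  heightAfter σ ξ ((List.ofFn ii).take k.1) (ii k)

/-- `x ∈ Im Ω̃_Q`. -/
def InImOmega (σ : Equiv.Perm J) (ξ : J → ℤ) {L : ℕ} (ii : Fin L → J) (x : J × ℤ) : Prop :=
  ∃ k : Fin L, ii k = x.1 ∧ heightAt σ ξ ii k = x.2

/-- A single commutation move. -/
def CommStep (C : CartanADE J) {L : ℕ} (ii jj : Fin L → J) : Prop :=
  ∃ (k : ℕ) (h1 : k < L) (h2 : k + 1 < L),
    C.a (ii ⟨k, h1⟩) (ii ⟨k + 1, h2⟩) = 0 ∧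
    jj = ii ∘ Equiv.swap (⟨k, h1⟩ : Fin L) ⟨k + 1, h2⟩

/-- Commutation equivalence of words. -/
def CommEquiv (C : CartanADE J) {L : ℕ} (ii jj : Fin L → J) : Prop :=
  Relation.ReflTransGen (CommStep C) ii jj

/-- The orbits of `ι` and `j` are adjacent (`\barι ∼ \barj` in `I₀`). -/
def adjOrbit (C : CartanADE J) (σ : Equiv.Perm J) (ι j : J) : Prop :=
  ∃ ι' j' : J, SameOrbit σ ι ι' ∧ SameOrbit σ j j' ∧ C.a ι' j' = -1

/-- `c ι j` is the Cartan matrix `c_{\barι \barj}` of the folded algebra `𝔤₀`. -/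
noncomputable def IsFoldedCartan (C : CartanADE J) (σ : Equiv.Perm J) (c : J → J → ℤ) : Prop :=
  ∀ ι j : J, (c ι j : ℚ) =
    if SameOrbit σ ι j then 2
    else if adjOrbit C σ ι j then -(max 1 ((orbitSize σ j : ℚ) / (orbitSize σ ι : ℚ)))
    else 0

/-- The basis element `ϖ_{\barι, p}` of `𝒫_ℤ`, realized as a function on `J × ℤ`
(the indicator of `orbit(ι) × {p}`). -/
noncomputable def varpiF (σ : Equiv.Perm J) (ι : J) (p : ℤ) : (J × ℤ) → ℤ :=
  fun y => if SameOrbit σ ι y.1 ∧ y.2 = p then 1 else 0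

/-- The ℓ-root `α_{\barι, p}`. -/
noncomputable def lrootF (σ : Equiv.Perm J) (c : J → J → ℤ) (ι : J) (p : ℤ) : (J × ℤ) → ℤ :=
  fun y => varpiF σ ι (p + (orbitSize σ ι : ℤ)) y + varpiF σ ι (p - (orbitSize σ ι : ℤ)) y
    - (if (¬ SameOrbit σ ι y.1) ∧
          ∃ k : ℤ, 1 ≤ k ∧ k ≤ -(c y.1 ι) ∧ y.2 = p - c y.1 ι + 1 - 2 * k
       then 1 else 0)

/-- `(\barι, p + 𝗌_{\barι}) ∈ Î₀`, i.e. the index `(\barι,p)` gives a valid ℓ-root. -/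
def ValidLRootIdx (σ : Equiv.Perm J) (ξ : J → ℤ) (ι : J) (p : ℤ) : Prop :=
  (2 : ℤ) ∣ (p + (orbitSize σ ι : ℤ) - ξ ι)

/-- The set of all ℓ-roots (generating `𝒬_ℤ`). -/
noncomputable def lrootSet (σ : Equiv.Perm J) (ξ : J → ℤ) (c : J → J → ℤ) :
    Set ((J × ℤ) → ℤ) :=
  {x | ∃ (ι : J) (p : ℤ), ValidLRootIdx σ ξ ι p ∧ x = lrootF σ c ι p}

/-- The ℤ-linear map `Ω_Q : ℤ^{R⁺} → 𝒫_ℤ`. -/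
noncomputable def OmegaQmap (C : CartanADE J) (σ : Equiv.Perm J) (ξ : J → ℤ) {L : ℕ}
    (ii : Fin L → J) (m : (J → ℤ) → ℤ) : (J × ℤ) → ℤ :=
  ∑ k : Fin L, m (betaOf C ii k) • varpiF σ (ii k) (heightAt σ ξ ii k)

set_option linter.unusedSectionVars false

section Orbits

lemma sameOrbit_iff (σ : Equiv.Perm J) (x y : J) : SameOrbit σ x y ↔ σ.SameCycle x y := by
  constructor
  · rintro ⟨k, hk⟩
    exact ⟨k, by simpa using hk⟩
  · intro h
    obtain ⟨k, -, hk⟩ := h.exists_pow_eq'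
    exact ⟨k, hk⟩

lemma so_refl (σ : Equiv.Perm J) (x : J) : SameOrbit σ x x := ⟨0, by simp⟩

lemma so_symm {σ : Equiv.Perm J} {x y : J} (h : SameOrbit σ x y) : SameOrbit σ y x := by
  rw [sameOrbit_iff] at *; exact h.symm

lemma so_trans {σ : Equiv.Perm J} {x y z : J} (h : SameOrbit σ x y) (h' : SameOrbit σ y z) :
    SameOrbit σ x z := by
  rw [sameOrbit_iff] at *; exact h.trans h'

/-- The orbit of `x` as a finset. -/
noncomputable def orb (σ : Equiv.Perm J) (x : J) : Finset J :=
  Finset.univ.filter (fun y => SameOrbit σ x y)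

lemma mem_orb {σ : Equiv.Perm J} {x y : J} : y ∈ orb σ x ↔ SameOrbit σ x y := by
  simp [orb]

lemma orb_eq_image (σ : Equiv.Perm J) (x : J) :
    (Finset.range (orderOf σ)).image (fun k => (σ ^ k) x) = orb σ x := by
  ext y
  simp only [Finset.mem_image, Finset.mem_range, mem_orb]
  constructor
  · rintro ⟨k, -, hk⟩
    exact ⟨k, hk⟩
  · rintro ⟨k, hk⟩
    refine ⟨k % orderOf σ, Nat.mod_lt _ (orderOf_pos σ), ?_⟩
    rw [pow_mod_orderOf]; exact hk

lemma orbitSize_eq (σ : Equiv.Perm J) (x : J) : orbitSize σ x = (orb σ x).card := by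
  rw [← orb_eq_image]; rfl

lemma orb_congr {σ : Equiv.Perm J} {x y : J} (h : SameOrbit σ x y) : orb σ x = orb σ y := by
  ext z
  simp only [mem_orb]
  exact ⟨fun h' => so_trans (so_symm h) h', fun h' => so_trans h h'⟩

lemma os_congr {σ : Equiv.Perm J} {x y : J} (h : SameOrbit σ x y) :
    orbitSize σ x = orbitSize σ y := by
  rw [orbitSize_eq, orbitSize_eq, orb_congr h]

lemma os_pos (σ : Equiv.Perm J) (x : J) : 0 < orbitSize σ x := by
  rw [orbitSize_eq]
  exact Finset.card_pos.2 ⟨x, mem_orb.2 (so_refl σ x)⟩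

lemma os_le (σ : Equiv.Perm J) (x : J) : orbitSize σ x ≤ orderOf σ := by
  unfold orbitSize
  exact Finset.card_image_le.trans (by simp)

lemma os_one {σ : Equiv.Perm J} {x y : J} (h : orbitSize σ x = 1) (hy : SameOrbit σ x y) :
    y = x := by
  rw [orbitSize_eq, Finset.card_eq_one] at h
  obtain ⟨a, ha⟩ := h
  have h1 : x ∈ orb σ x := mem_orb.2 (so_refl σ x)
  have h2 : y ∈ orb σ x := mem_orb.2 hy
  rw [ha, Finset.mem_singleton] at h1 h2
  rw [h1, h2]

lemma a_pow (C : CartanADE J) (D : DiagAut C) (k : ℕ) (x y : J) :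
    C.a ((D.σ ^ k) x) ((D.σ ^ k) y) = C.a x y := by
  induction k with
  | zero => simp
  | succ k ih => rw [pow_succ', Equiv.Perm.mul_apply, Equiv.Perm.mul_apply, D.compat, ih]

lemma a_orb (C : CartanADE J) (D : DiagAut C) {x y : J} (h : SameOrbit D.σ x y) (hne : y ≠ x) :
    C.a x y = 0 := by
  obtain ⟨k, rfl⟩ := h
  have := D.noAdj x k hne
  rcases C.offDiag x _ (Ne.symm hne) with h | h
  · exact h
  · exact absurd h this

end Orbits

section Form

/-- Sum of Cartan entries over a product of two finsets. -/
def EE (C : CartanADE J) (S T : Finset J) : ℤ := ∑ x ∈ S, ∑ y ∈ T, C.a x y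

lemma EE_symm (C : CartanADE J) (S T : Finset J) : EE C S T = EE C T S := by
  unfold EE
  rw [Finset.sum_comm]
  exact Finset.sum_congr rfl fun _ _ => Finset.sum_congr rfl fun _ _ => C.symm _ _

lemma EE_union_left (C : CartanADE J) {S S' : Finset J} (T : Finset J) (h : Disjoint S S') :
    EE C (S ∪ S') T = EE C S T + EE C S' T := by
  unfold EE; rw [Finset.sum_union h]

lemma EE_union_right (C : CartanADE J) {S S' : Finset J} (T : Finset J) (h : Disjoint S S') :
    EE C T (S ∪ S') = EE C T S + EE C T S' := by
  rw [EE_symm, EE_union_left C T h, EE_symm, EE_symm C S']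

lemma EE_union (C : CartanADE J) {S T : Finset J} (h : Disjoint S T) :
    EE C (S ∪ T) (S ∪ T) = EE C S S + EE C T T + 2 * EE C S T := by
  rw [EE_union_left C _ h, EE_union_right C _ h, EE_union_right C _ h, EE_symm C T S]; ring

lemma EE_pos (C : CartanADE J) {S : Finset J} (h : S.Nonempty) : 0 < EE C S S := by
  obtain ⟨x, hx⟩ := h
  have := C.posDef (fun y => if y ∈ S then 1 else 0) (by
    intro h
    have := congrFun h x
    simp [hx] at this)
  have e : (∑ ι : J, ∑ j : J, (if ι ∈ S then (1:ℚ) else 0) * (C.a ι j : ℚ) *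
      (if j ∈ S then (1:ℚ) else 0)) = ((EE C S S : ℤ) : ℚ) := by
    unfold EE
    push_cast
    simp only [mul_ite, ite_mul, one_mul, zero_mul, mul_one, mul_zero]
    simp [Finset.sum_ite_mem]
  rw [e] at this
  exact_mod_cast this

/-- Row sum. -/
def row (C : CartanADE J) (S : Finset J) (x : J) : ℤ := ∑ y ∈ S, C.a x y

/-- `σ`-stable finset. -/
def Stab (σ : Equiv.Perm J) (S : Finset J) : Prop := ∀ x y, SameOrbit σ x y → x ∈ S → y ∈ S

lemma row_pow (C : CartanADE J) (D : DiagAut C) {S : Finset J} (hS : Stab D.σ S) {x x' : J}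
    (h : SameOrbit D.σ x x') : row C S x' = row C S x := by
  obtain ⟨k, rfl⟩ := h
  unfold row
  symm
  refine Finset.sum_bij (fun y _ => (D.σ ^ k) y) ?_ ?_ ?_ ?_
  · intro y hy; exact hS y _ ⟨k, rfl⟩ hy
  · intro a _ b _ h; exact (D.σ ^ k).injective h
  · intro b hb
    refine ⟨(D.σ ^ k).symm b, hS b _ (so_symm ⟨k, by simp⟩) hb, by simp⟩
  · intro y _; rw [a_pow]

lemma stab_orb (σ : Equiv.Perm J) (x : J) : Stab σ (orb σ x) := by
  intro y z h hy
  rw [mem_orb] at *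
  exact so_trans hy h

lemma row_orb_self (C : CartanADE J) (D : DiagAut C) (x : J) : row C (orb D.σ x) x = 2 := by
  unfold row
  rw [Finset.sum_eq_single x]
  · exact C.diag x
  · intro b hb hne; exact a_orb C D (mem_orb.1 hb) hne
  · intro h; exact absurd (mem_orb.2 (so_refl _ _)) h

lemma EE_orb_left (C : CartanADE J) (D : DiagAut C) {S : Finset J} (hS : Stab D.σ S) (x : J) :
    EE C (orb D.σ x) S = (orbitSize D.σ x : ℤ) * row C S x := by
  have h1 : EE C (orb D.σ x) S = ∑ y ∈ orb D.σ x, row C S y := rfl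
  have h2 : ∑ y ∈ orb D.σ x, row C S y = ∑ y ∈ orb D.σ x, row C S x :=
    Finset.sum_congr rfl (fun y hy => row_pow C D hS (mem_orb.1 hy))
  rw [h1, h2]
  simp [orbitSize_eq]

lemma EE_orb (C : CartanADE J) (D : DiagAut C) (x : J) :
    EE C (orb D.σ x) (orb D.σ x) = 2 * (orbitSize D.σ x : ℤ) := by
  rw [EE_orb_left C D (stab_orb _ _), row_orb_self]; ring

lemma a_nonpos (C : CartanADE J) {x y : J} (h : x ≠ y) : C.a x y ≤ 0 := by
  rcases C.offDiag x y h with h | h <;> omega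

lemma row_two (C : CartanADE J) {S : Finset J} {x u u' : J} (hx : x ∉ S) (hu : u ∈ S) (hu' : u' ∈ S)
    (hne : u ≠ u') (h : C.a x u = -1) (h' : C.a x u' = -1) : row C S x ≤ -2 := by
  unfold row
  rw [← Finset.add_sum_erase _ _ hu, ← Finset.add_sum_erase (S.erase u) _ (Finset.mem_erase.2 ⟨hne.symm, hu'⟩)]
  have : ∑ y ∈ (S.erase u).erase u', C.a x y ≤ 0 := by
    apply Finset.sum_nonpos
    intro y hy
    apply a_nonpos
    rintro rfl
    simp at hy; exact hx hy.2.2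
  linarith

lemma row_one (C : CartanADE J) {S : Finset J} {x u : J} (hx : x ∉ S) (hu : u ∈ S) 
    (h : C.a x u = -1) : row C S x ≤ -1 := by
  unfold row
  rw [← Finset.add_sum_erase _ _ hu]
  have : ∑ y ∈ (S.erase u), C.a x y ≤ 0 := by
    apply Finset.sum_nonpos
    intro y hy
    apply a_nonpos
    rintro rfl
    simp at hy; exact hx hy.2
  linarith

lemma EE_single (C : CartanADE J) (S : Finset J) (x : J) : EE C {x} S = row C S x := by
  simp [EE, row]

lemma growth (C : CartanADE J) (D : DiagAut C) {S : Finset J} (hS : Stab D.σ S)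
    (hne : S.Nonempty) (hq : EE C S S = 2) (hu : S ≠ Finset.univ) :
    ∃ κ, κ ∉ S ∧ ∃ u ∈ S, C.a κ u = -1 ∧ (∀ u' ∈ S, C.a κ u' = -1 → u' = u) ∧
      Stab D.σ (S ∪ orb D.σ κ) ∧ EE C (S ∪ orb D.σ κ) (S ∪ orb D.σ κ) = 2 := by
  have : ∃ u ∈ S, ∃ κ, C.a u κ = -1 ∧ κ ∉ S := by
    by_contra hcon
    push Not at hcon
    have := C.indec (S : Set J) (by simpa using hne) (by
      intro ι hι j hj
      exact hcon ι hι j hj)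
    apply hu
    ext x
    have : x ∈ (S : Set J) := by rw [this]; trivial
    simpa using this
  obtain ⟨u, hu, κ, hκu, hκ⟩ := this
  rw [C.symm] at hκu
  have hr1 := row_one C hκ hu hκu
  have hd : Disjoint S {κ} := by simpa using hκ
  have hq' := EE_pos C (S := S ∪ {κ}) (hne.mono Finset.subset_union_left)
  rw [EE_union C hd, hq, EE_symm C S, EE_single, EE_single] at hq'
  have h2 : row C {κ} κ = 2 := by simp [row, C.diag]
  have hr : row C S κ = -1 := by omega
  have hd' : Disjoint S (orb D.σ κ) := by
    rw [Finset.disjoint_left]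
    intro x hx hx'
    exact hκ (hS x κ (so_symm (mem_orb.1 hx')) hx)
  refine ⟨κ, hκ, u, hu, hκu, ?_, ?_, ?_⟩
  · intro u' hu' h'
    by_contra hne
    have := row_two C hκ hu' hu hne h' hκu
    omega
  · intro x y h hx
    rw [Finset.mem_union] at *
    exact hx.imp (hS x y h) (stab_orb _ _ x y h)
  · rw [EE_union C hd', hq, EE_orb, EE_symm, EE_orb_left C D hS, hr]; ring

/-- Trivial diagram automorphism. -/
def trivAut (C : CartanADE J) : DiagAut C where
  σ := 1
  compat := by intros; rfl
  noAdj := by intro ι k h; simp at h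

lemma grow_all (C : CartanADE J) (D : DiagAut C) (P : J → Prop)
    (hP : ∀ κ u, P u → C.a κ u = -1 → 
       (∀ k : ℕ, (D.σ ^ k) κ = κ → (D.σ ^ k) u = u) → P κ)
    (hPorb : ∀ x y, SameOrbit D.σ x y → P x → P y)
    (o : J) (ho : EE C (orb D.σ o) (orb D.σ o) = 2) (hPo : P o) :
    (∀ x, P x) ∧ EE C Finset.univ Finset.univ = 2 := by
  have key : ∀ n : ℕ, ∀ S : Finset J, (Finset.univ \ S).card = n → S.Nonempty → Stab D.σ S →
      EE C S S = 2 → (∀ x ∈ S, P x) → (∀ x, P x) ∧ EE C Finset.univ Finset.univ = 2 := by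
    intro n
    induction n using Nat.strong_induction_on with
    | _ n ih =>
      intro S hn hne hS hq hPS
      by_cases hu : S = Finset.univ
      · subst hu; exact ⟨fun x => hPS x (Finset.mem_univ x), hq⟩
      · obtain ⟨κ, hκ, u, hu, hκu, huniq, hst, hq'⟩ := growth C D hS hne hq hu
        have hκm : κ ∈ orb D.σ κ := mem_orb.2 (so_refl _ _)
        refine ih _ ?_ (S ∪ orb D.σ κ) rfl (hne.mono Finset.subset_union_left) hst hq' ?_
        · rw [← hn]
          apply Finset.card_lt_card
          rw [Finset.ssubset_iff_of_subset]
          · exact ⟨κ, by simp [hκ], by simp [hκm]⟩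
          · exact Finset.sdiff_subset_sdiff (le_refl _) Finset.subset_union_left
        · intro x hx
          rw [Finset.mem_union] at hx
          rcases hx with hx | hx
          · exact hPS x hx
          · refine hPorb κ x (mem_orb.1 hx) (hP κ u (hPS u hu) hκu ?_)
            intro k hk
            apply huniq _ (hS _ _ ⟨k, rfl⟩ hu)
            rw [← hκu, ← a_pow C D k κ u, hk]
  refine key _ _ rfl ⟨o, mem_orb.2 (so_refl _ _)⟩ (stab_orb _ _) ho ?_
  intro x hx; exact hPorb o x (mem_orb.1 hx) hPo

lemma EE_univ (C : CartanADE J) (o : J) : EE C Finset.univ Finset.univ = 2 := by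
  refine (grow_all C (trivAut C) (fun _ => True) (by simp) (by simp) o ?_ trivial).2
  rw [EE_orb]
  have : orbitSize (trivAut C).σ o = 1 := by
    simp [orbitSize, trivAut]
  rw [this]; rfl

lemma exists_fixed_aux (C : CartanADE J) (D : DiagAut C) (n : ℕ) : ∀ S : Finset J, S.card = n →
    Stab D.σ S → EE C S S = 2 → ∃ o, orbitSize D.σ o = 1 := by
  induction n using Nat.strong_induction_on with
  | _ n ih =>
    intro S hn hS hq
    have : ∃ x ∈ S, 0 < row C S x := by
      by_contra hcon
      push Not at hcon
      have : EE C S S ≤ 0 := Finset.sum_nonpos hcon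
      omega
    obtain ⟨x, hx, hr⟩ := this
    have hrow : row C S x = 2 + row C (S.erase x) x := by
      unfold row
      rw [← Finset.add_sum_erase _ _ hx, C.diag]
    by_cases h1 : row C S x = 2
    · have hS1 : S.erase x = ∅ := by
        by_contra hne
        have hp := EE_pos C (Finset.nonempty_iff_ne_empty.2 hne)
        have hd : Disjoint {x} (S.erase x) := by simp
        have hu : {x} ∪ S.erase x = S := by
          rw [← Finset.insert_eq, Finset.insert_erase hx]
        have := EE_union C hd
        rw [hu, hq, EE_single, EE_single] at this
        have h2 : row C {x} x = 2 := by simp [row, C.diag]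
        omega
      refine ⟨x, ?_⟩
      rw [orbitSize_eq, Finset.card_eq_one]
      refine ⟨x, ?_⟩
      ext y
      simp only [mem_orb, Finset.mem_singleton]
      constructor
      · intro h
        by_contra hne
        have : y ∈ S.erase x := Finset.mem_erase.2 ⟨hne, hS x y h hx⟩
        rw [hS1] at this; simp at this
      · rintro rfl; exact so_refl _ _
    · have hle : row C (S.erase x) x ≤ 0 := by
        apply Finset.sum_nonpos
        intro y hy
        exact a_nonpos C (Finset.ne_of_mem_erase hy).symm
      have hr1 : row C S x = 1 := by omega
      have hsub : orb D.σ x ⊆ S := fun y hy => hS x y (mem_orb.1 hy) hx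
      have hd : Disjoint (orb D.σ x) (S \ orb D.σ x) := Finset.disjoint_sdiff
      have hu : orb D.σ x ∪ (S \ orb D.σ x) = S := Finset.union_sdiff_of_subset hsub
      have e1 := EE_union C hd
      have e2 := EE_union_right C (orb D.σ x) hd
      rw [hu] at e1 e2
      rw [EE_orb_left C D hS, hr1, EE_orb] at e2
      rw [hq, EE_orb] at e1
      refine ih _ ?_ (S \ orb D.σ x) rfl ?_ (by omega)
      · rw [← hn]
        apply Finset.card_lt_card
        rw [Finset.ssubset_iff_of_subset Finset.sdiff_subset]
        exact ⟨x, hx, by simp [mem_orb, so_refl]⟩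
      · intro y z h hy
        rw [Finset.mem_sdiff] at *
        exact ⟨hS y z h hy.1, fun hz => hy.2 (stab_orb _ _ z y (so_symm h) hz)⟩

lemma exists_fixed (C : CartanADE J) (D : DiagAut C) (x : J) : ∃ o, orbitSize D.σ o = 1 :=
  exists_fixed_aux C D _ Finset.univ rfl (by intro _ _ _ _; simp) (EE_univ C x)

/-- Uniqueness of neighbours in orbits of equal size. -/
lemma nbr_unique (C : CartanADE J) (D : DiagAut C) {x y y' : J} (hs : orbitSize D.σ x = orbitSize D.σ y)
    (hy : C.a x y = -1) (hy' : C.a x y' = -1) (h : SameOrbit D.σ y y') : y = y' := by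
  by_contra hne
  have hxy : ¬ SameOrbit D.σ x y := by
    intro h
    by_cases e : y = x
    · subst e; rw [C.diag] at hy; omega
    · rw [a_orb C D h e] at hy; omega
  have hd : Disjoint (orb D.σ x) (orb D.σ y) := by
    rw [Finset.disjoint_left]
    intro z hz hz'
    exact hxy (so_trans (mem_orb.1 hz) (so_symm (mem_orb.1 hz')))
  have := EE_pos C (S := orb D.σ x ∪ orb D.σ y) ⟨x, by simp [mem_orb, so_refl]⟩
  rw [EE_union C hd, EE_orb, EE_orb, EE_orb_left C D (stab_orb _ _), hs] at this
  have h2 := row_two C (S := orb D.σ y) (x := x) (fun h => hxy (so_symm (mem_orb.1 h)))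
    (mem_orb.2 (so_refl _ _)) (mem_orb.2 h) hne hy hy'
  have h3 : (0:ℤ) < orbitSize D.σ y := by exact_mod_cast os_pos _ _
  nlinarith

end Form
section Heights

lemma a_ne_of_adj (C : CartanADE J) {x y : J} (h : C.a x y = -1) : x ≠ y := by
  rintro rfl; rw [C.diag] at h; omega

lemma not_so_of_adj (C : CartanADE J) (D : DiagAut C) {x y : J} (h : C.a x y = -1) :
    ¬ SameOrbit D.σ x y := by
  intro h'
  rw [a_orb C D h' (a_ne_of_adj C h).symm] at h; omega

/-- Consequences of condition (b). -/
lemma cond_b (C : CartanADE J) (D : DiagAut C) (ξ : J → ℤ) (hξ : IsHeightFunction C D ξ) {x y : J}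
    (h : C.a x y = -1) (hs : orbitSize D.σ x < orbitSize D.σ y) :
    orbitSize D.σ y = orderOf D.σ ∧ ∃ j0, SameOrbit D.σ y j0 ∧ |ξ x - ξ j0| = 1 ∧
      (∀ k : ℕ, k < orderOf D.σ → ξ ((D.σ ^ k) j0) = ξ j0 - 2 * (k : ℤ)) ∧
      (∀ z, SameOrbit D.σ y z → ∃ k : ℕ, k < orderOf D.σ ∧ z = (D.σ ^ k) j0) := by
  obtain ⟨j0, ⟨hj0, habs, hk⟩, -⟩ := hξ.2 x y h hs
  refine ⟨?_, j0, hj0, habs, hk, ?_⟩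
  · rw [os_congr hj0]
    unfold orbitSize
    rw [Finset.card_image_of_injOn, Finset.card_range]
    intro k hk1 k' hk2 e
    simp only [Finset.coe_range, Set.mem_Iio] at hk1 hk2
    have e' : (D.σ ^ k) j0 = (D.σ ^ k') j0 := e
    have h1 := hk k hk1
    have h2 := hk k' hk2
    rw [e'] at h1
    omega
  · intro z hz
    have : z ∈ orb D.σ j0 := mem_orb.2 (so_trans (so_symm hj0) hz)
    rw [← orb_eq_image] at this
    simp only [Finset.mem_image, Finset.mem_range] at this
    obtain ⟨k, h1, h2⟩ := this
    exact ⟨k, h1, h2.symm⟩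

/-- Residues of `ξ` distinguish the members of the orbit. -/
def DistRes (σ : Equiv.Perm J) (ξ : J → ℤ) (x : J) : Prop :=
  ∀ y y', SameOrbit σ x y → SameOrbit σ x y' → (2 * (orbitSize σ x : ℤ)) ∣ ξ y - ξ y' → y = y'

lemma pow_transfer {σ : Equiv.Perm J} {κ u : J} (h : ∀ k : ℕ, (σ ^ k) κ = κ → (σ ^ k) u = u)
    (k k' : ℕ) (e : (σ ^ k) κ = (σ ^ k') κ) : (σ ^ k) u = (σ ^ k') u := by
  wlog hle : k ≤ k' generalizing k k'
  · exact (this k' k e.symm (by omega)).symm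
  obtain ⟨d, rfl⟩ := Nat.exists_eq_add_of_le hle
  rw [pow_add, Equiv.Perm.mul_apply] at e ⊢
  rw [h d ((σ ^ k).injective e.symm)]

lemma int_zero_of {s e : ℤ} (hs : 0 < s) (h1 : -(2 * s) < 2 * s * e) (h2 : 2 * s * e < 2 * s) : e = 0 := by
  have a1 : e < 1 := by nlinarith
  have a2 : -1 < e := by nlinarith
  omega

lemma all_good (C : CartanADE J) (D : DiagAut C) (ξ : J → ℤ) (hξ : IsHeightFunction C D ξ) (x : J) :
    (orbitSize D.σ x = 1 ∨ orbitSize D.σ x = orderOf D.σ) ∧ DistRes D.σ ξ x := by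
  obtain ⟨o, ho⟩ := exists_fixed C D x
  have one_dist : ∀ y, orbitSize D.σ y = 1 → DistRes D.σ ξ y := by
    intro y hy z z' hz hz' _
    rw [os_one hy hz, os_one hy hz']
  refine (grow_all C D (fun x => (orbitSize D.σ x = 1 ∨ orbitSize D.σ x = orderOf D.σ) ∧
    DistRes D.σ ξ x) ?_ ?_ o ?_ ⟨Or.inl ho, one_dist o ho⟩).1 x
  · rintro κ u ⟨hu, hdu⟩ hκu hst
    have huκ : C.a u κ = -1 := by rw [C.symm]; exact hκu
    by_cases h1 : orbitSize D.σ κ = 1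
    · exact ⟨Or.inl h1, one_dist κ h1⟩
    have hκpos := os_pos D.σ κ
    by_cases hlt : orbitSize D.σ u < orbitSize D.σ κ
    · obtain ⟨hr, j0, hj0, -, hk, hall⟩ := cond_b C D ξ hξ huκ hlt
      refine ⟨Or.inr hr, ?_⟩
      intro y y' hy hy' hdvd
      obtain ⟨k, hk1, rfl⟩ := hall y hy
      obtain ⟨k', hk2, rfl⟩ := hall y' hy'
      rw [hk k hk1, hk k' hk2, hr] at hdvd
      obtain ⟨e, he⟩ := hdvd
      have : e = 0 := int_zero_of (s := (orderOf D.σ : ℤ)) (by exact_mod_cast orderOf_pos D.σ)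
        (by omega) (by omega)
      subst this
      have : k = k' := by omega
      rw [this]
    · have hur : orbitSize D.σ u = orderOf D.σ := by
        rcases hu with hu | hu
        · omega
        · exact hu
      have hsz : orbitSize D.σ κ = orbitSize D.σ u := by
        have := os_le D.σ κ
        have h2 : orbitSize D.σ u ≤ orbitSize D.σ κ := by
          rw [orbitSize_eq, orbitSize_eq]
          choose! f hf using (fun y (hy : y ∈ orb D.σ κ) => mem_orb.1 hy)
          refine Finset.card_le_card_of_surjOn (fun y => (D.σ ^ (f y)) u) ?_
          intro z hz
          obtain ⟨k, rfl⟩ := mem_orb.1 (Finset.mem_coe.1 hz)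
          have hm : (D.σ ^ k) κ ∈ orb D.σ κ := mem_orb.2 ⟨k, rfl⟩
          exact ⟨(D.σ ^ k) κ, hm, pow_transfer hst _ _ (hf _ hm)⟩
        omega
      refine ⟨Or.inr (by omega), ?_⟩
      rintro y y' ⟨k, rfl⟩ ⟨k', rfl⟩ hdvd
      have adj : ∀ k : ℕ, C.a ((D.σ ^ k) κ) ((D.σ ^ k) u) = -1 := fun k => by rw [a_pow, hκu]
      have sz : ∀ k : ℕ, orbitSize D.σ ((D.σ ^ k) κ) = orbitSize D.σ ((D.σ ^ k) u) := fun k => by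
        rw [← os_congr (⟨k, rfl⟩ : SameOrbit D.σ κ ((D.σ ^ k) κ)),
          ← os_congr (⟨k, rfl⟩ : SameOrbit D.σ u ((D.σ ^ k) u)), hsz]
      have szκ : ∀ k : ℕ, orbitSize D.σ ((D.σ ^ k) κ) = orbitSize D.σ u := fun k => by
        rw [← os_congr (⟨k, rfl⟩ : SameOrbit D.σ κ ((D.σ ^ k) κ)), hsz]
      have e1 := hξ.1 _ _ (adj k) (sz k)
      have e2 := hξ.1 _ _ (adj k') (sz k')
      rw [szκ] at e1 e2
      rw [hsz] at hdvd
      have hu' : (D.σ ^ k) u = (D.σ ^ k') u := by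
        refine hdu _ _ ⟨k, rfl⟩ ⟨k', rfl⟩ ?_
        obtain ⟨e, he⟩ := hdvd
        rcases (abs_eq (by positivity)).1 e1 with e1 | e1 <;>
        rcases (abs_eq (by positivity)).1 e2 with e2 | e2
        · exact ⟨e, by linarith⟩
        · exact ⟨e - 1, by linarith⟩
        · exact ⟨e + 1, by linarith⟩
        · exact ⟨e, by linarith⟩
      have so : SameOrbit D.σ ((D.σ ^ k) κ) ((D.σ ^ k') κ) :=
        so_trans (so_symm ⟨k, rfl⟩) ⟨k', rfl⟩
      refine nbr_unique C D (x := (D.σ ^ k) u) (sz k).symm ?_ ?_ so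
      · rw [C.symm]; exact adj k
      · rw [C.symm, hu']; exact adj k'
  · rintro x y h ⟨h1, h2⟩
    rw [os_congr h] at h1
    refine ⟨h1, ?_⟩
    intro z z' hz hz' hd
    rw [← os_congr h] at hd
    exact h2 z z' (so_trans h hz) (so_trans h hz') hd
  · rw [EE_orb, ho]; rfl

/-- Initial edge bound. -/
lemma edge_bound (C : CartanADE J) (D : DiagAut C) (ξ : J → ℤ) (hξ : IsHeightFunction C D ξ) {x y : J}
    (h : C.a x y = -1) : ξ x - ξ y < 2 * (orbitSize D.σ y : ℤ) := by
  have hx := os_pos D.σ x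
  have hy := os_pos D.σ y
  rcases lt_trichotomy (orbitSize D.σ x) (orbitSize D.σ y) with hs | hs | hs
  · obtain ⟨hr, j0, hj0, habs, hk, hall⟩ := cond_b C D ξ hξ h hs
    obtain ⟨k, hk1, e⟩ := hall y (so_refl _ _)
    have := hk k hk1
    rw [← e] at this
    have := (abs_le.1 habs.le).2
    omega
  · have := hξ.1 x y h hs
    have := (abs_le.1 this.le).2
    omega
  · have h' : C.a y x = -1 := by rw [C.symm]; exact h
    obtain ⟨hr, j0, hj0, habs, hk, hall⟩ := cond_b C D ξ hξ h' hs
    obtain ⟨k, hk1, e⟩ := hall x (so_refl _ _)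
    have := hk k hk1
    rw [← e] at this
    have := (abs_le.1 habs.le).1
    omega

lemma c_adj {C : CartanADE J} {D : DiagAut C} {c : J → J → ℤ}
    (hc : IsFoldedCartan C D.σ c) {x y κ : J} (h : C.a x y = -1) (hκ : SameOrbit D.σ y κ) :
    (c κ x : ℚ) = -(max 1 ((orbitSize D.σ x : ℚ) / (orbitSize D.σ y : ℚ))) := by
  have h1 : ¬ SameOrbit D.σ κ x := fun h' => not_so_of_adj C D h (so_symm (so_trans hκ h'))
  have h2 : adjOrbit C D.σ κ x := ⟨y, x, so_symm hκ, so_refl _ _, by rw [C.symm]; exact h⟩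
  rw [hc κ x, if_neg h1, if_pos h2, os_congr hκ]

lemma c_nonadj {C : CartanADE J} {D : DiagAut C} {c : J → J → ℤ}
    (hc : IsFoldedCartan C D.σ c) {x κ : J} (h1 : ¬ SameOrbit D.σ x κ)
    (h : ∀ y, C.a x y = -1 → ¬ SameOrbit D.σ y κ) : c κ x = 0 := by
  have h1 : ¬ SameOrbit D.σ κ x := fun h' => h1 (so_symm h')
  have h2 : ¬ adjOrbit C D.σ κ x := by
    rintro ⟨y, x', hy, hx', ha⟩
    obtain ⟨k, hk⟩ := so_symm hx'
    refine h ((D.σ ^ k) y) ?_ (so_symm (so_trans hy ⟨k, rfl⟩))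
    rw [← hk, a_pow, C.symm]; exact ha
  have := hc κ x
  rw [if_neg h1, if_neg h2] at this
  exact_mod_cast this

lemma lemN {C : CartanADE J} {D : DiagAut C} {ξ : J → ℤ} (hξ : IsHeightFunction C D ξ)
    {c : J → J → ℤ} (hc : IsFoldedCartan C D.σ c) (x κ : J) (p z : ℤ)
    (hp : 2 * (orbitSize D.σ x : ℤ) ∣ p - ξ x) :
    (∑ j ∈ Finset.univ.filter (fun j => C.a x j = -1),
      if SameOrbit D.σ j κ ∧ p - 2 * (orbitSize D.σ x : ℤ) < z ∧ z < p ∧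
        2 * (orbitSize D.σ j : ℤ) ∣ z - ξ j then (1 : ℤ) else 0) =
    if (¬ SameOrbit D.σ x κ) ∧ ∃ k : ℤ, 1 ≤ k ∧ k ≤ -(c κ x) ∧
      z = (p - (orbitSize D.σ x : ℤ)) - c κ x + 1 - 2 * k then 1 else 0 := by
  by_cases hex : ∃ y, C.a x y = -1 ∧ SameOrbit D.σ y κ
  swap
  · have hne : ∀ y, C.a x y = -1 → ¬ SameOrbit D.σ y κ := fun y h1 h2 => hex ⟨y, h1, h2⟩
    rw [Finset.sum_eq_zero, if_neg]
    · rintro ⟨h1, k, hk1, hk2, -⟩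
      rw [c_nonadj hc h1 hne] at hk2
      omega
    · intro j hj
      rw [if_neg]
      intro h
      exact hne j (by simpa using hj) h.1
  obtain ⟨y, hxy, hyκ⟩ := hex
  have hnso : ¬ SameOrbit D.σ x κ := fun h => not_so_of_adj C D hxy (so_trans h (so_symm hyκ))
  have hcq := c_adj hc hxy hyκ
  have hxpos : (0:ℤ) < orbitSize D.σ x := by exact_mod_cast os_pos D.σ x
  have hypos : (0:ℤ) < orbitSize D.σ y := by exact_mod_cast os_pos D.σ y
  have hxposQ : (0:ℚ) < orbitSize D.σ x := by exact_mod_cast hxpos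
  have hyposQ : (0:ℚ) < orbitSize D.σ y := by exact_mod_cast hypos
  obtain ⟨a, ha⟩ := hp
  rcases lt_trichotomy (orbitSize D.σ x) (orbitSize D.σ y) with hs | hs | hs
  · -- small next to large
    obtain ⟨hr, j0, hj0, habs, hk, hall⟩ := cond_b C D ξ hξ hxy hs
    have hx1 : orbitSize D.σ x = 1 := by
      rcases (all_good C D ξ hξ x).1 with h | h
      · exact h
      · omega
    have hc1 : c κ x = -1 := by
      rw [max_eq_left] at hcq
      · exact_mod_cast hcq
      · rw [div_le_one hyposQ]; exact_mod_cast hs.le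
    have hadj : ∀ j, SameOrbit D.σ y j → C.a x j = -1 := by
      rintro j ⟨k, rfl⟩
      have : (D.σ ^ k) x = x := os_one hx1 ⟨k, rfl⟩
      rw [← hxy, ← a_pow C D k x y, this]
    rw [hc1, hx1]
    rw [hx1] at ha
    have hrpos : (0:ℤ) < orderOf D.σ := by exact_mod_cast orderOf_pos D.σ
    by_cases hz : z = p - 1
    · rw [if_pos ⟨hnso, 1, le_refl _, by simp, by push_cast; omega⟩]
      -- find the unique index
      have heven : ∃ t, z - ξ j0 = 2 * t := by
        rcases (abs_eq (by norm_num)).1 habs with h | h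
        · exact ⟨a, by push_cast at ha; omega⟩
        · exact ⟨a - 1, by push_cast at ha; omega⟩
      obtain ⟨t, ht⟩ := heven
      set k : ℕ := ((-t) % (orderOf D.σ : ℤ)).toNat with hkdef
      have hk0 : (k : ℤ) = (-t) % (orderOf D.σ : ℤ) := Int.toNat_of_nonneg (Int.emod_nonneg _ hrpos.ne')
      have hklt : k < orderOf D.σ := by
        have := Int.emod_lt_of_pos (-t) hrpos
        omega
      have hsok : SameOrbit D.σ y ((D.σ ^ k) j0) := so_trans hj0 ⟨k, rfl⟩
      rw [Finset.sum_eq_single ((D.σ ^ k) j0)]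
      · rw [if_pos]
        refine ⟨so_trans (so_symm hsok) hyκ, by push_cast; omega, by omega, ?_⟩
        rw [← os_congr hsok, hr, hk k hklt]
        refine ⟨-((-t) / (orderOf D.σ : ℤ)), ?_⟩
        have := Int.emod_add_mul_ediv (-t) (orderOf D.σ : ℤ)
        rw [← hk0] at this
        linear_combination ht + 2 * this
      · intro j hj hne
        rw [if_neg]
        rintro ⟨h1, -, -, h4⟩
        apply hne
        have hyj : SameOrbit D.σ y j := so_trans hyκ (so_symm h1)
        refine (all_good C D ξ hξ y).2 _ _ hyj hsok ?_
        rw [← os_congr hyj] at h4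
        obtain ⟨e, he⟩ := h4
        rw [hk k hklt]
        rw [hr] at he ⊢
        have := Int.emod_add_mul_ediv (-t) (orderOf D.σ : ℤ)
        rw [← hk0] at this
        refine ⟨-e - ((-t) / (orderOf D.σ : ℤ)), ?_⟩
        linear_combination ht - he + 2 * this
      · intro h
        exact absurd (by simpa using hadj _ hsok) h
    · rw [if_neg]
      · apply Finset.sum_eq_zero
        intro j hj
        rw [if_neg]
        rintro ⟨-, h2, h3, -⟩
        apply hz; push_cast at h2; omega
      · rintro ⟨-, k, h1, h2, h3⟩
        apply hz; push_cast at h3; omega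
  · -- equal sizes
    have hc1 : c κ x = -1 := by
      rw [hs, div_self hyposQ.ne', max_self] at hcq
      exact_mod_cast hcq
    rw [hc1, Finset.sum_eq_single y]
    · have habs := hξ.1 x y hxy hs
      rw [← hs] at *
      congr 1
      apply propext
      constructor
      · rintro ⟨-, h2, h3, e, he⟩
        refine ⟨hnso, 1, le_refl _, by simp, ?_⟩
        have : ∃ f, z - p + (orbitSize D.σ x : ℤ) = 2 * (orbitSize D.σ x : ℤ) * f := by
          rcases (abs_eq hxpos.le).1 habs with h | h
          · exact ⟨e - a, by linear_combination he - ha - h⟩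
          · exact ⟨e - a + 1, by linear_combination he - ha - h⟩
        obtain ⟨f, hf⟩ := this
        have : f = 0 := int_zero_of hxpos (by omega) (by omega)
        subst this
        omega
      · rintro ⟨-, k, hk1, hk2, hk3⟩
        refine ⟨hyκ, by omega, by omega, ?_⟩
        have hz : z = p - orbitSize D.σ x := by omega
        rcases (abs_eq hxpos.le).1 habs with h | h
        · exact ⟨a, by linear_combination hz + ha + h⟩
        · exact ⟨a - 1, by linear_combination hz + ha + h⟩
    · intro j hj hne
      rw [if_neg]
      rintro ⟨h1, -⟩
      exact hne (nbr_unique C D hs hxy (by simpa using hj) (so_trans hyκ (so_symm h1))).symm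
    · intro h; exact absurd (by simpa using hxy) h
  · -- large next to small
    have hyx : C.a y x = -1 := by rw [C.symm]; exact hxy
    obtain ⟨hr, j0, hj0, habs, hk, hall⟩ := cond_b C D ξ hξ hyx hs
    have hy1 : orbitSize D.σ y = 1 := by
      rcases (all_good C D ξ hξ y).1 with h | h
      · exact h
      · omega
    have hc1 : c κ x = -(orbitSize D.σ x : ℤ) := by
      rw [max_eq_right, hy1] at hcq
      · have : (c κ x : ℚ) = ((-(orbitSize D.σ x : ℤ) : ℤ) : ℚ) := by rw [hcq]; push_cast; simp
        exact_mod_cast this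
      · rw [one_le_div hyposQ]; exact_mod_cast hs.le
    have hodd : ∃ e, ξ x = ξ y + 1 + 2 * e := by
      obtain ⟨k, hk1, e⟩ := hall x (so_refl _ _)
      have := hk k hk1
      rw [← e] at this
      rcases (abs_eq (by norm_num)).1 habs with h | h
      · exact ⟨-1 - k, by omega⟩
      · exact ⟨-k, by omega⟩
    obtain ⟨e, he⟩ := hodd
    rw [hc1, Finset.sum_eq_single y]
    · congr 1
      apply propext
      rw [hy1]
      constructor
      · rintro ⟨-, h2, h3, f, hf⟩
        refine ⟨hnso, e + (orbitSize D.σ x : ℤ) * a - f + 1, ?_, ?_, ?_⟩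
        · push_cast at hf; nlinarith
        · push_cast at hf; nlinarith
        · push_cast at hf; linear_combination hf - ha - he
      · rintro ⟨-, k, hk1, hk2, hk3⟩
        refine ⟨hyκ, by omega, by omega, e + (orbitSize D.σ x : ℤ) * a - k + 1, ?_⟩
        push_cast
        linear_combination hk3 + ha + he
    · intro j hj hne
      rw [if_neg]
      rintro ⟨h1, -⟩
      exact hne (os_one hy1 (so_trans hyκ (so_symm h1)))
    · intro h; exact absurd (by simpa using hxy) h

end Heights
section Dynamics

/-- Boundary term. -/
noncomputable def bb (C : CartanADE J) (D : DiagAut C) (y : J × ℤ) (η : J → ℤ) (x : J) : ℤ :=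
  varpiF D.σ x (η x) y - ∑ j ∈ Finset.univ.filter (fun j => C.a x j = -1),
    if SameOrbit D.σ j y.1 ∧ η x < y.2 ∧ y.2 < η x + 2 * (orbitSize D.σ x : ℤ) ∧ y.2 ≤ η j ∧
      2 * (orbitSize D.σ j : ℤ) ∣ y.2 - η j then 1 else 0

lemma refl_sum (C : CartanADE J) (g : J → ℤ) (ι : J) :
    ∑ κ : J, g κ * C.a κ ι = 2 * g ι - ∑ x ∈ Finset.univ.erase ι, if C.a ι x = -1 then g x else 0 := by
  rw [← Finset.add_sum_erase _ _ (Finset.mem_univ ι), C.diag]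
  have : ∑ x ∈ Finset.univ.erase ι, g x * C.a x ι
      = - ∑ x ∈ Finset.univ.erase ι, if C.a ι x = -1 then g x else 0 := by
    rw [← Finset.sum_neg_distrib]
    refine Finset.sum_congr rfl fun x hx => ?_
    rw [C.symm x ι]
    rcases C.offDiag ι x (Finset.ne_of_mem_erase hx).symm with h | h <;> simp [h]
  rw [this]; ring

lemma bb_other (C : CartanADE J) (D : DiagAut C) (y : J × ℤ) (η : J → ℤ) (ι : J)
    (hedge : ∀ x z, C.a x z = -1 → η x - η z < 2 * (orbitSize D.σ z : ℤ))
    (hsrc : IsSource C η ι) (x : J) (hx : x ≠ ι) :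
    bb C D y (fun j => η j - if j = ι then 2 * (orbitSize D.σ ι : ℤ) else 0) x =
      bb C D y η x + if C.a ι x = -1 then varpiF D.σ ι (η ι) y else 0 := by
  have hpos : (0:ℤ) < orbitSize D.σ ι := by exact_mod_cast os_pos D.σ ι
  unfold bb
  simp only [if_neg hx, sub_zero]
  by_cases h : C.a ι x = -1
  · have h' : C.a x ι = -1 := by rw [C.symm]; exact h
    have hm : ι ∈ Finset.univ.filter (fun j => C.a x j = -1) := by simpa using h'
    rw [if_pos h, ← Finset.add_sum_erase _ _ hm, ← Finset.add_sum_erase (Finset.univ.filter (fun j => C.a x j = -1)) (fun j => if SameOrbit D.σ j y.1 ∧ η x < y.2 ∧ y.2 < η x + 2 * (orbitSize D.σ x : ℤ) ∧ y.2 ≤ η j ∧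
      2 * (orbitSize D.σ j : ℤ) ∣ y.2 - η j then (1:ℤ) else 0) hm]
    rw [Finset.sum_congr rfl (g := fun j => if SameOrbit D.σ j y.1 ∧ η x < y.2 ∧ y.2 < η x + 2 * (orbitSize D.σ x : ℤ) ∧ y.2 ≤ η j ∧
      2 * (orbitSize D.σ j : ℤ) ∣ y.2 - η j then (1:ℤ) else 0)]
    swap
    · intro j hj
      rw [if_neg (Finset.ne_of_mem_erase hj), sub_zero]
    have h1 := hsrc x h
    have h2 := hedge ι x h
    have hv : varpiF D.σ ι (η ι) y = if SameOrbit D.σ ι y.1 ∧ y.2 = η ι then 1 else 0 := rfl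
    rw [hv]
    simp only [if_true]
    by_cases hso : SameOrbit D.σ ι y.1
    swap
    · simp [hso]
    by_cases hz : y.2 = η ι
    · rw [if_neg (by omega), if_pos ⟨hso, by omega, by omega, by omega, by simp [hz]⟩, if_pos ⟨hso, hz⟩]
      ring
    · rw [if_neg (c := SameOrbit D.σ ι y.1 ∧ y.2 = η ι) (fun h => hz h.2), add_zero]
      congr 2
      congr 1
      apply propext
      constructor
      · rintro ⟨a1, a2, a3, a4, e, he⟩
        exact ⟨a1, a2, a3, by omega, e - 1, by linarith⟩
      · rintro ⟨a1, a2, a3, a4, e, he⟩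
        refine ⟨a1, a2, a3, ?_, e + 1, by linarith⟩
        have : e < 0 := by
          have : 2 * (orbitSize D.σ ι : ℤ) * e < 0 := by omega
          by_contra hcon
          nlinarith
        nlinarith
  · rw [if_neg h, add_zero]
    congr 1
    refine Finset.sum_congr rfl fun j hj => ?_
    have : j ≠ ι := by
      rintro rfl
      apply h; rw [C.symm]; simpa using hj
    rw [if_neg this, sub_zero]

lemma bb_self_old (C : CartanADE J) (D : DiagAut C) (y : J × ℤ) (η : J → ℤ) (ι : J)
    (hsrc : IsSource C η ι) : bb C D y η ι = varpiF D.σ ι (η ι) y := by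
  unfold bb
  rw [Finset.sum_eq_zero, sub_zero]
  intro j hj
  have := hsrc j (by simpa using hj)
  rw [if_neg (by omega)]

lemma bb_self_new {C : CartanADE J} {D : DiagAut C} {ξ : J → ℤ} (hξ : IsHeightFunction C D ξ)
    {c : J → J → ℤ} (hc : IsFoldedCartan C D.σ c) (y : J × ℤ) (η : J → ℤ) (ι : J)
    (hcong : ∀ x, 2 * (orbitSize D.σ x : ℤ) ∣ η x - ξ x)
    (hedge : ∀ x z, C.a x z = -1 → η x - η z < 2 * (orbitSize D.σ z : ℤ))
    (hsrc : IsSource C η ι) :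
    bb C D y (fun j => η j - if j = ι then 2 * (orbitSize D.σ ι : ℤ) else 0) ι =
      lrootF D.σ c ι (η ι - orbitSize D.σ ι) y - varpiF D.σ ι (η ι) y := by
  unfold lrootF
  rw [← lemN hξ hc ι y.1 (η ι) y.2 (hcong ι)]
  unfold bb
  simp only [if_true, sub_add_cancel]
  have e : η ι - (orbitSize D.σ ι : ℤ) - (orbitSize D.σ ι : ℤ) = η ι - 2 * (orbitSize D.σ ι : ℤ) := by ring
  rw [e]
  rw [Finset.sum_congr rfl (g := fun j => if SameOrbit D.σ j y.1 ∧ η ι - 2 * (orbitSize D.σ ι : ℤ) < y.2 ∧ y.2 < η ι ∧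
        2 * (orbitSize D.σ j : ℤ) ∣ y.2 - ξ j then (1 : ℤ) else 0)]
  · ring
  intro j hj
  have hj' : C.a ι j = -1 := by simpa using hj
  rw [if_neg (a_ne_of_adj C hj').symm, sub_zero]
  congr 1
  apply propext
  have hd : (2 * (orbitSize D.σ j : ℤ) ∣ y.2 - η j) ↔ (2 * (orbitSize D.σ j : ℤ) ∣ y.2 - ξ j) := by
    have : y.2 - ξ j = (y.2 - η j) + (η j - ξ j) := by ring
    rw [this, dvd_add_left (hcong j)]
  rw [hd]
  constructor
  · rintro ⟨a1, a2, a3, a4, a5⟩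
    exact ⟨a1, a2, by omega, a5⟩
  · rintro ⟨a1, a2, a3, a4⟩
    refine ⟨a1, a2, by omega, ?_, a4⟩
    by_contra hcon
    obtain ⟨e, he⟩ := hd.2 a4
    have h2 := hedge ι j hj'
    have hpos : (0:ℤ) < orbitSize D.σ j := by exact_mod_cast os_pos D.σ j
    have : 0 < e := by
      by_contra h; nlinarith
    nlinarith

lemma step {C : CartanADE J} {D : DiagAut C} {ξ : J → ℤ} (hξ : IsHeightFunction C D ξ)
    {c : J → J → ℤ} (hc : IsFoldedCartan C D.σ c) (y : J × ℤ) (η : J → ℤ) (ι : J)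
    (hcong : ∀ x, 2 * (orbitSize D.σ x : ℤ) ∣ η x - ξ x)
    (hedge : ∀ x z, C.a x z = -1 → η x - η z < 2 * (orbitSize D.σ z : ℤ))
    (hsrc : IsSource C η ι) (g : J → ℤ) (d : ℤ) :
    ∑ x, (reflS C ι g + d • simpleRoot ι) x *
        bb C D y (fun j => η j - if j = ι then 2 * (orbitSize D.σ ι : ℤ) else 0) x
      = ∑ x, g x * bb C D y η x +
        ((reflS C ι g + d • simpleRoot ι) ι * lrootF D.σ c ι (η ι - orbitSize D.σ ι) y
          - d * varpiF D.σ ι (η ι) y) := by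
  have g'self : (reflS C ι g + d • simpleRoot ι) ι = - g ι +
      (∑ x ∈ Finset.univ.erase ι, if C.a ι x = -1 then g x else 0) + d := by
    simp [reflS, simpleRoot, refl_sum]; ring
  have g'other : ∀ x, x ≠ ι → (reflS C ι g + d • simpleRoot ι) x = g x := by
    intro x hx
    simp [reflS, simpleRoot, hx]
  rw [← Finset.add_sum_erase _ _ (Finset.mem_univ ι), ← Finset.add_sum_erase _ (fun x => g x * bb C D y η x) (Finset.mem_univ ι)]
  rw [bb_self_new hξ hc y η ι hcong hedge hsrc, bb_self_old C D y η ι hsrc]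
  have : ∑ x ∈ Finset.univ.erase ι, (reflS C ι g + d • simpleRoot ι) x *
        bb C D y (fun j => η j - if j = ι then 2 * (orbitSize D.σ ι : ℤ) else 0) x =
      ∑ x ∈ Finset.univ.erase ι, g x * bb C D y η x +
      (∑ x ∈ Finset.univ.erase ι, if C.a ι x = -1 then g x else 0) * varpiF D.σ ι (η ι) y := by
    rw [Finset.sum_mul, ← Finset.sum_add_distrib]
    refine Finset.sum_congr rfl fun x hx => ?_
    have hx := Finset.ne_of_mem_erase hx
    rw [g'other x hx, bb_other C D y η ι hedge hsrc x hx]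
    split_ifs <;> ring
  rw [this, g'self]
  ring

/-- Height function after `k` steps. -/
noncomputable def HH (σ : Equiv.Perm J) (ξ : J → ℤ) {L : ℕ} (ii : Fin L → J) (k : ℕ) : J → ℤ :=
  heightAfter σ ξ ((List.ofFn ii).take k)

lemma take_succ' {L : ℕ} (ii : Fin L → J) {k : ℕ} (hk : k < L) :
    (List.ofFn ii).take (k + 1) = (List.ofFn ii).take k ++ [ii ⟨k, hk⟩] := by
  rw [List.take_succ_eq_append_getElem (by simpa using hk)]
  simp

lemma HH_zero (σ : Equiv.Perm J) (ξ : J → ℤ) {L : ℕ} (ii : Fin L → J) : HH σ ξ ii 0 = ξ := by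
  simp [HH, heightAfter]

lemma HH_succ (σ : Equiv.Perm J) (ξ : J → ℤ) {L : ℕ} (ii : Fin L → J) {k : ℕ} (hk : k < L) :
    HH σ ξ ii (k + 1) = fun j => HH σ ξ ii k j -
      if j = ii ⟨k, hk⟩ then 2 * (orbitSize σ (ii ⟨k, hk⟩) : ℤ) else 0 := by
  unfold HH
  rw [take_succ' ii hk]
  simp [heightAfter]

lemma HH_cong (σ : Equiv.Perm J) (ξ : J → ℤ) {L : ℕ} (ii : Fin L → J) (k : ℕ) (hk : k ≤ L) (x : J) :
    2 * (orbitSize σ x : ℤ) ∣ HH σ ξ ii k x - ξ x := by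
  induction k with
  | zero => simp [HH_zero]
  | succ k ih =>
    rw [HH_succ σ ξ ii hk]
    obtain ⟨e, he⟩ := ih (by omega)
    by_cases h : x = ii ⟨k, hk⟩
    · simp only [← h, if_true]
      exact ⟨e - 1, by linarith⟩
    · simp only [if_neg h, sub_zero]
      exact ⟨e, he⟩

lemma HH_edge {C : CartanADE J} {D : DiagAut C} {ξ : J → ℤ} (hξ : IsHeightFunction C D ξ)
    {L : ℕ} {ii : Fin L → J} (ha : IsAdapted C D ξ ii) (k : ℕ) (hk : k ≤ L) (x z : J)
    (h : C.a x z = -1) :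
    HH D.σ ξ ii k x - HH D.σ ξ ii k z < 2 * (orbitSize D.σ z : ℤ) := by
  induction k with
  | zero => rw [HH_zero]; exact edge_bound C D ξ hξ h
  | succ k ih =>
    have ih := ih (by omega)
    rw [HH_succ D.σ ξ ii hk]
    have hsrc : IsSource C (HH D.σ ξ ii k) (ii ⟨k, hk⟩) := ha ⟨k, hk⟩
    have hpos : (0:ℤ) < orbitSize D.σ (ii ⟨k, hk⟩) := by exact_mod_cast os_pos _ _
    by_cases hx : x = ii ⟨k, hk⟩
    · have hz : z ≠ ii ⟨k, hk⟩ := by rw [← hx]; exact (a_ne_of_adj C h).symm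
      simp only [if_pos hx, if_neg hz]
      omega
    · simp only [if_neg hx]
      by_cases hz : z = ii ⟨k, hk⟩
      · rw [if_pos hz]
        have := hsrc x (by rw [← hz, C.symm]; exact h)
        rw [← hz] at this ⊢
        omega
      · rw [if_neg hz]; omega

/-- The vectors `w_k⁻¹ (-∑_{t<k} d_t β_t)`. -/
def gg (C : CartanADE J) {L : ℕ} (ii : Fin L → J) (d : Fin L → ℤ) : ℕ → J → ℤ
  | 0 => 0
  | k + 1 => if h : k < L then reflS C (ii ⟨k, h⟩) (gg C ii d k) + d ⟨k, h⟩ • simpleRoot (ii ⟨k, h⟩)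
      else gg C ii d k

lemma gg_succ (C : CartanADE J) {L : ℕ} (ii : Fin L → J) (d : Fin L → ℤ) {k : ℕ} (h : k < L) :
    gg C ii d (k + 1) = reflS C (ii ⟨k, h⟩) (gg C ii d k) + d ⟨k, h⟩ • simpleRoot (ii ⟨k, h⟩) := by
  rw [gg, dif_pos h]

lemma filter_lt_succ {L k : ℕ} (h : k < L) :
    Finset.univ.filter (fun t : Fin L => t.1 < k + 1) =
      insert ⟨k, h⟩ (Finset.univ.filter (fun t : Fin L => t.1 < k)) := by
  ext t
  simp only [Finset.mem_filter, Finset.mem_univ, true_and, Finset.mem_insert, Fin.ext_iff]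
  omega

lemma main_identity {C : CartanADE J} {D : DiagAut C} {ξ : J → ℤ} (hξ : IsHeightFunction C D ξ)
    {c : J → J → ℤ} (hc : IsFoldedCartan C D.σ c)
    {L : ℕ} {ii : Fin L → J} (ha : IsAdapted C D ξ ii) (d : Fin L → ℤ) (y : J × ℤ)
    (k : ℕ) (hk : k ≤ L) :
    ∑ x, gg C ii d k x * bb C D y (HH D.σ ξ ii k) x =
    ∑ t ∈ Finset.univ.filter (fun t : Fin L => t.1 < k),
      (gg C ii d (t.1 + 1) (ii t) * lrootF D.σ c (ii t) (heightAt D.σ ξ ii t - orbitSize D.σ (ii t)) y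
        - d t * varpiF D.σ (ii t) (heightAt D.σ ξ ii t) y) := by
  induction k with
  | zero => simp [gg]
  | succ k ih =>
    rw [filter_lt_succ hk, Finset.sum_insert (by simp), ← ih (by omega), HH_succ D.σ ξ ii hk,
      gg_succ C ii d hk]
    rw [step hξ hc y (HH D.σ ξ ii k) (ii ⟨k, hk⟩) (HH_cong D.σ ξ ii k (by omega))
      (HH_edge hξ ha k (by omega)) (ha ⟨k, hk⟩) (gg C ii d k) (d ⟨k, hk⟩)]
    rw [add_comm]
    rfl

lemma final_identity {C : CartanADE J} {D : DiagAut C} {ξ : J → ℤ} (hξ : IsHeightFunction C D ξ)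
    {c : J → J → ℤ} (hc : IsFoldedCartan C D.σ c)
    {L : ℕ} {ii : Fin L → J} (ha : IsAdapted C D ξ ii) (d : Fin L → ℤ) (hL : gg C ii d L = 0) :
    ∑ t, d t • varpiF D.σ (ii t) (heightAt D.σ ξ ii t) =
    ∑ t, gg C ii d (t.1 + 1) (ii t) •
      lrootF D.σ c (ii t) (heightAt D.σ ξ ii t - orbitSize D.σ (ii t)) := by
  ext y
  have := main_identity hξ hc ha d y L le_rfl
  rw [hL] at this
  simp only [Pi.zero_apply, zero_mul, Finset.sum_const_zero, Fin.is_lt, Finset.filter_true,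
    Finset.sum_sub_distrib] at this
  simp only [Finset.sum_apply, Pi.smul_apply, smul_eq_mul]
  linarith

lemma HH_anti (σ : Equiv.Perm J) (ξ : J → ℤ) {L : ℕ} (ii : Fin L → J) (x : J) {k k' : ℕ}
    (h : k ≤ k') (hk' : k' ≤ L) : HH σ ξ ii k' x ≤ HH σ ξ ii k x := by
  induction k', h using Nat.le_induction with
  | base => exact le_rfl
  | succ n hn ih =>
    refine le_trans ?_ (ih (by omega))
    rw [HH_succ σ ξ ii hk']
    simp only
    split_ifs <;> simp

lemma pos_distinct {C : CartanADE J} {D : DiagAut C} {ξ : J → ℤ} (hξ : IsHeightFunction C D ξ)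
    {L : ℕ} (ii : Fin L → J) (k t : Fin L) (hso : SameOrbit D.σ (ii k) (ii t))
    (hp : heightAt D.σ ξ ii k = heightAt D.σ ξ ii t) : k = t := by
  have hp' : HH D.σ ξ ii k.1 (ii k) = HH D.σ ξ ii t.1 (ii t) := hp
  have e : ii k = ii t := by
    refine (all_good C D ξ hξ (ii k)).2 _ _ (so_refl _ _) hso ?_
    obtain ⟨a, ha⟩ := HH_cong D.σ ξ ii k.1 k.2.le (ii k)
    obtain ⟨b, hb⟩ := HH_cong D.σ ξ ii t.1 t.2.le (ii t)
    rw [← os_congr hso] at hb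
    exact ⟨b - a, by linear_combination hb - ha + hp'⟩
  wlog hlt : k ≤ t generalizing k t
  · exact (this t k (so_symm hso) hp.symm hp'.symm e.symm (le_of_not_ge hlt)).symm
  by_contra hne
  have hlt' : k.1 + 1 ≤ t.1 := by
    have := Fin.lt_def.1 (lt_of_le_of_ne hlt hne)
    omega
  have h1 := HH_anti D.σ ξ ii (ii t) hlt' t.2.le
  rw [HH_succ D.σ ξ ii k.2] at h1
  have hpos : (0:ℤ) < orbitSize D.σ (ii k) := by exact_mod_cast os_pos _ _
  simp only [Fin.eta, e, if_true] at h1 hp' hpos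
  omega

end Dynamics
section Weyl

lemma reflS_add (C : CartanADE J) (ι : J) (v w : J → ℤ) :
    reflS C ι (v + w) = reflS C ι v + reflS C ι w := by
  ext j
  simp only [reflS, Pi.add_apply, add_mul, Finset.sum_add_distrib]; ring

lemma reflS_smul (C : CartanADE J) (ι : J) (a : ℤ) (v : J → ℤ) :
    reflS C ι (a • v) = a • reflS C ι v := by
  ext j
  simp only [reflS, Pi.smul_apply, smul_eq_mul, mul_assoc, ← Finset.mul_sum]; ring

lemma reflS_reflS (C : CartanADE J) (ι : J) (v : J → ℤ) : reflS C ι (reflS C ι v) = v := by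
  ext j
  have : ∑ κ : J, (reflS C ι v) κ * C.a κ ι = - ∑ κ : J, v κ * C.a κ ι := by
    simp only [reflS, sub_mul, Finset.sum_sub_distrib, simpleRoot]
    simp [C.diag]; ring
  rw [reflS, this]
  simp only [reflS]; ring

lemma reflS_root (C : CartanADE J) (ι : J) : reflS C ι (simpleRoot ι) = (-1 : ℤ) • simpleRoot ι := by
  ext j
  simp [reflS, simpleRoot, C.diag]
  split_ifs <;> norm_num

/-- Simple reflection as a linear map. -/
def reflL (C : CartanADE J) (ι : J) : (J → ℤ) →ₗ[ℤ] (J → ℤ) where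
  toFun := reflS C ι
  map_add' := reflS_add C ι
  map_smul' := reflS_smul C ι

lemma applyRefls_inj (C : CartanADE J) (w : List J) (v : J → ℤ) (h : applyRefls C w v = 0) : v = 0 := by
  induction w with
  | nil => exact h
  | cons ι w ih =>
    apply ih
    have h' : reflS C ι (applyRefls C w v) = 0 := h
    rw [← reflS_reflS C ι (applyRefls C w v), h']
    exact (reflL C ι).map_zero

lemma applyRefls_add (C : CartanADE J) (w : List J) (v v' : J → ℤ) :
    applyRefls C w (v + v') = applyRefls C w v + applyRefls C w v' := by
  induction w with
  | nil => rfl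
  | cons ι w ih =>
    change reflS C ι (applyRefls C w _) = reflS C ι (applyRefls C w _) + reflS C ι (applyRefls C w _)
    rw [ih, reflS_add]

lemma applyRefls_smul (C : CartanADE J) (w : List J) (a : ℤ) (v : J → ℤ) :
    applyRefls C w (a • v) = a • applyRefls C w v := by
  induction w with
  | nil => rfl
  | cons ι w ih =>
    change reflS C ι (applyRefls C w _) = a • reflS C ι (applyRefls C w _)
    rw [ih, reflS_smul]

lemma applyRefls_append (C : CartanADE J) (w : List J) (ι : J) (v : J → ℤ) :
    applyRefls C (w ++ [ι]) v = applyRefls C w (reflS C ι v) := by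
  simp [applyRefls]

lemma W_gg (C : CartanADE J) {L : ℕ} (ii : Fin L → J) (d : Fin L → ℤ) (k : ℕ) (hk : k ≤ L) :
    applyRefls C ((List.ofFn ii).take k) (gg C ii d k) =
      - ∑ t ∈ Finset.univ.filter (fun t : Fin L => t.1 < k), d t • betaOf C ii t := by
  induction k with
  | zero => simp [gg, applyRefls]
  | succ k ih =>
    rw [filter_lt_succ hk, Finset.sum_insert (by simp), take_succ' ii hk, applyRefls_append,
      gg_succ C ii d hk, reflS_add, reflS_smul, reflS_reflS, reflS_root, applyRefls_add,
      applyRefls_smul, applyRefls_smul, ih (by omega)]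
    simp only [betaOf]
    module

lemma gg_final (C : CartanADE J) {L : ℕ} (ii : Fin L → J) (d : Fin L → ℤ)
    (h : ∑ t, d t • betaOf C ii t = 0) : gg C ii d L = 0 := by
  have := W_gg C ii d L le_rfl
  simp only [Fin.is_lt, Finset.filter_true, h, neg_zero] at this
  exact applyRefls_inj C _ _ this

lemma pQ_add_left (C : CartanADE J) (v v' w : J → ℚ) :
    pairingQ C (v + v') w = pairingQ C v w + pairingQ C v' w := by
  simp [pairingQ, add_mul, Finset.sum_add_distrib]

lemma pQ_smul_left (C : CartanADE J) (a : ℚ) (v w : J → ℚ) :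
    pairingQ C (a • v) w = a * pairingQ C v w := by
  simp [pairingQ, mul_assoc, Finset.mul_sum]

lemma pQ_symm (C : CartanADE J) (v w : J → ℚ) : pairingQ C v w = pairingQ C w v := by
  unfold pairingQ
  rw [Finset.sum_comm]
  refine Finset.sum_congr rfl fun x _ => Finset.sum_congr rfl fun y _ => ?_
  rw [C.symm]; ring

/-- The pairing as a linear functional in the second variable. -/
def pQL (C : CartanADE J) (v : J → ℚ) : (J → ℚ) →ₗ[ℚ] ℚ where
  toFun := pairingQ C v
  map_add' := by intro x y; rw [pQ_symm, pQ_add_left, pQ_symm C x, pQ_symm C y]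
  map_smul' := by intro a y; rw [pQ_symm, pQ_smul_left, pQ_symm C y]; rfl

lemma pQL_apply (C : CartanADE J) (v w : J → ℚ) : pQL C v w = pairingQ C v w := rfl

/-- Rational simple root. -/
def srQ (ι : J) : J → ℚ := fun j => if j = ι then 1 else 0

lemma pQ_sr (C : CartanADE J) (v : J → ℚ) (ι : J) :
    pairingQ C v (srQ ι) = ∑ κ : J, v κ * (C.a κ ι : ℚ) := by
  simp [pairingQ, srQ]

lemma reflQ_eq (C : CartanADE J) (ι : J) (v : J → ℚ) :
    reflQ C ι v = v + (-(pairingQ C v (srQ ι))) • srQ ι := by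
  ext j
  rw [pQ_sr]
  simp only [reflQ, srQ, Pi.add_apply, Pi.smul_apply, smul_eq_mul]; ring

lemma pQ_add_right (C : CartanADE J) (v w w' : J → ℚ) :
    pairingQ C v (w + w') = pairingQ C v w + pairingQ C v w' := by
  rw [pQ_symm, pQ_add_left, pQ_symm C w, pQ_symm C w']

lemma pQ_smul_right (C : CartanADE J) (a : ℚ) (v w : J → ℚ) :
    pairingQ C v (a • w) = a * pairingQ C v w := by
  rw [pQ_symm, pQ_smul_left, pQ_symm C w]

lemma reflQ_iso (C : CartanADE J) (ι : J) (v w : J → ℚ) :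
    pairingQ C (reflQ C ι v) (reflQ C ι w) = pairingQ C v w := by
  have h2 : pairingQ C (srQ ι) (srQ ι) = 2 := by
    rw [pQ_sr]; simp [srQ, C.diag]
  rw [reflQ_eq, reflQ_eq, pQ_add_left, pQ_smul_left, pQ_add_right, pQ_add_right,
    pQ_smul_right, pQ_smul_right, h2, pQ_symm C v (srQ ι), pQ_symm C w (srQ ι)]
  ring

lemma applyReflsQ_iso (C : CartanADE J) (l : List J) (v w : J → ℚ) :
    pairingQ C (applyReflsQ C l v) (applyReflsQ C l w) = pairingQ C v w := by
  induction l with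
  | nil => rfl
  | cons ι l ih =>
    change pairingQ C (reflQ C ι (applyReflsQ C l v)) (reflQ C ι (applyReflsQ C l w)) = _
    rw [reflQ_iso, ih]

/-- Cast of integral vectors. -/
def cQ (v : J → ℤ) : J → ℚ := fun j => (v j : ℚ)

lemma reflQ_cast (C : CartanADE J) (ι : J) (v : J → ℤ) : reflQ C ι (cQ v) = cQ (reflS C ι v) := by
  ext j
  simp [reflQ, cQ, reflS, simpleRoot]

lemma applyReflsQ_cast (C : CartanADE J) (l : List J) (v : J → ℤ) :
    applyReflsQ C l (cQ v) = cQ (applyRefls C l v) := by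
  induction l with
  | nil => rfl
  | cons ι l ih =>
    change reflQ C ι (applyReflsQ C l (cQ v)) = cQ (reflS C ι (applyRefls C l v))
    rw [ih, reflQ_cast]

lemma fund_pair {C : CartanADE J} {Λ : J → J → ℚ} (hΛ : IsFundWeights C Λ) (ι : J) (w : J → ℚ) :
    pairingQ C (Λ ι) w = w ι := by
  have e : w = ∑ j, w j • srQ j := by
    ext k; simp [srQ]
  conv_lhs => rw [e]
  rw [← pQL_apply, map_sum]
  simp only [map_smul, pQL_apply]
  have : ∀ j, pairingQ C (Λ ι) (srQ j) = if ι = j then 1 else 0 := by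
    intro j
    rw [← hΛ ι j]
    congr 1
    ext k; simp [srQ, simpleRoot]
  simp [this]

lemma rho_eq {C : CartanADE J} {Λ : J → J → ℚ} (hΛ : IsFundWeights C Λ) {L : ℕ} (ii : Fin L → J)
    (m : (J → ℤ) → ℤ) (r : Fin L) :
    rhoOf C ii Λ m r = (gg C ii (fun t => m (betaOf C ii t)) (r.1 + 1) (ii r) : ℚ) := by
  set d : Fin L → ℤ := fun t => m (betaOf C ii t) with hd
  have h1 : rhoOf C ii Λ m r = pairingQ C (nuOf C ii Λ r)
      (cQ (∑ t ∈ Finset.univ.filter (fun t : Fin L => t.1 < r.1 + 1), d t • betaOf C ii t)) := by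
    have e : cQ (∑ t ∈ Finset.univ.filter (fun t : Fin L => t.1 < r.1 + 1), d t • betaOf C ii t) =
      ∑ t ∈ Finset.univ.filter (fun t : Fin L => t ≤ r), (d t : ℚ) • betaQ C ii t := by
      have hf : Finset.univ.filter (fun t : Fin L => t.1 < r.1 + 1) = Finset.univ.filter (fun t : Fin L => t ≤ r) := by
        ext t; simp only [Finset.mem_filter, Finset.mem_univ, true_and, Fin.le_def]; omega
      rw [hf]
      ext j
      simp [cQ, betaQ, Finset.sum_apply]
    rw [e, ← pQL_apply, map_sum]
    simp only [map_smul, pQL_apply, smul_eq_mul]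
    rfl
  have h2 := W_gg C ii d (r.1 + 1) r.2
  have h3 : ∑ t ∈ Finset.univ.filter (fun t : Fin L => t.1 < r.1 + 1), d t • betaOf C ii t =
    applyRefls C ((List.ofFn ii).take (r.1 + 1)) ((-1 : ℤ) • gg C ii d (r.1 + 1)) := by
    rw [applyRefls_smul, h2]; simp
  rw [h1, h3, ← applyReflsQ_cast]
  have h4 : nuOf C ii Λ r = (-1 : ℚ) • applyReflsQ C ((List.ofFn ii).take (r.1 + 1)) (Λ (ii r)) := by
    simp [nuOf]
  rw [h4, pQ_smul_left, applyReflsQ_iso, fund_pair hΛ]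
  simp [cQ]

lemma gg_sub (C : CartanADE J) {L : ℕ} (ii : Fin L → J) (d d' : Fin L → ℤ) (k : ℕ) (hk : k ≤ L) :
    gg C ii (fun t => d t - d' t) k = gg C ii d k - gg C ii d' k := by
  induction k with
  | zero => simp [gg]
  | succ k ih =>
    rw [gg_succ C ii _ hk, gg_succ C ii _ hk, gg_succ C ii _ hk, ih (by omega)]
    have : reflS C (ii ⟨k, hk⟩) (gg C ii d k - gg C ii d' k) =
      reflS C (ii ⟨k, hk⟩) (gg C ii d k) - reflS C (ii ⟨k, hk⟩) (gg C ii d' k) := (reflL C _).map_sub _ _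
    rw [this]
    module

lemma posRoots_finite {C : CartanADE J} {Λ : J → J → ℚ} (hΛ : IsFundWeights C Λ) :
    (posRoots C).Finite := by
  have hb : ∀ v ∈ posRoots C, ∀ ι, ((v ι : ℚ)) ^ 2 ≤ 2 * pairingQ C (Λ ι) (Λ ι) := by
    intro v hv ι
    have hvv : pairingQ C (cQ v) (cQ v) = 2 := by
      have := hv.2.2
      have h : ((pairing C v v : ℤ) : ℚ) = pairingQ C (cQ v) (cQ v) := by
        simp [pairing, pairingQ, cQ]
      rw [← h, this]; norm_num
    have nonneg : ∀ u : J → ℚ, 0 ≤ pairingQ C u u := by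
      intro u
      by_cases hu : u = 0
      · subst hu; simp [pairingQ]
      · exact (C.posDef u hu).le
    have := nonneg (Λ ι + (-(v ι : ℚ) / 2) • cQ v)
    rw [pQ_add_left, pQ_smul_left, ← pQL_apply, ← pQL_apply, map_add, map_add, map_smul, map_smul] at this
    simp only [pQL_apply, smul_eq_mul, hvv, pQ_symm C (cQ v) (Λ ι), fund_pair hΛ ι (cQ v)] at this
    simp only [cQ] at this
    nlinarith
  choose N hN using fun ι => exists_nat_gt (2 * pairingQ C (Λ ι) (Λ ι))
  refine (Set.finite_Icc (0 : J → ℤ) (fun ι => (N ι : ℤ))).subset ?_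
  intro v hv
  refine ⟨fun ι => hv.1 ι, fun ι => ?_⟩
  have h1 := hb v hv ι
  have h2 : ((v ι ^ 2 : ℤ) : ℚ) < ((N ι : ℤ) : ℚ) := by push_cast; exact lt_of_le_of_lt h1 (hN ι)
  have h3 : v ι ^ 2 < (N ι : ℤ) := by exact_mod_cast h2
  have h0 := hv.1 ι
  show v ι ≤ (N ι : ℤ)
  nlinarith

lemma beta_image {C : CartanADE J} {Λ : J → J → ℚ} (hΛ : IsFundWeights C Λ) {L : ℕ} {ii : Fin L → J}
    (hr : IsReducedWord C ii) : Set.range (betaOf C ii) = posRoots C := by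
  have hfin := posRoots_finite hΛ
  refine Set.eq_of_subset_of_ncard_le ?_ ?_ hfin
  · rintro _ ⟨k, rfl⟩; exact hr.2.2 k
  · rw [← hr.1, ← Set.image_univ, Set.ncard_image_of_injective _ hr.2.1]
    simp [Set.ncard_univ]

lemma kp_sum {C : CartanADE J} {Λ : J → J → ℚ} (hΛ : IsFundWeights C Λ) {L : ℕ} {ii : Fin L → J}
    (hr : IsReducedWord C ii) {β : J → ℤ} {m : (J → ℤ) → ℤ} (hm : IsKP C β m) :
    ∑ t, m (betaOf C ii t) • betaOf C ii t = β := by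
  rw [← hm.2.2, ← beta_image hΛ hr, finsum_mem_range hr.2.1, finsum_eq_sum_of_fintype]

end Weyl

section Independence

lemma lrootF_congr {C : CartanADE J} {D : DiagAut C} {c : J → J → ℤ}
    (hc : IsFoldedCartan C D.σ c) {x x' : J} (h : SameOrbit D.σ x x') (p : ℤ) :
    lrootF D.σ c x p = lrootF D.σ c x' p := by
  have hso : ∀ y, SameOrbit D.σ x y ↔ SameOrbit D.σ x' y := fun y =>
    ⟨fun h' => so_trans (so_symm h) h', fun h' => so_trans h h'⟩
  have hso' : ∀ y, SameOrbit D.σ y x ↔ SameOrbit D.σ y x' := fun y =>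
    ⟨fun h' => so_trans h' h, fun h' => so_trans h' (so_symm h)⟩
  have hcc : ∀ y, c y x = c y x' := by
    intro y
    have h1 := hc y x
    have h2 := hc y x'
    have h3 : adjOrbit C D.σ y x ↔ adjOrbit C D.σ y x' := by
      unfold adjOrbit
      simp only [hso]
    simp only [hso', h3, os_congr h] at h1
    rw [← h2] at h1
    exact_mod_cast h1
  ext y
  unfold lrootF varpiF
  simp only [hso, hcc, os_congr h]

/-- Orbit representative. -/
noncomputable def rep (σ : Equiv.Perm J) (x : J) : J :=
  (Quotient.mk (⟨SameOrbit σ, so_refl σ, so_symm, so_trans⟩ : Setoid J) x).out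

lemma rep_so (σ : Equiv.Perm J) (x : J) : SameOrbit σ x (rep σ x) := by
  have := Quotient.mk_out (s := (⟨SameOrbit σ, so_refl σ, so_symm, so_trans⟩ : Setoid J)) x
  exact so_symm this

lemma rep_eq {σ : Equiv.Perm J} {x y : J} (h : SameOrbit σ x y) : rep σ x = rep σ y := by
  unfold rep
  congr 1
  exact Quotient.sound (s := (⟨SameOrbit σ, so_refl σ, so_symm, so_trans⟩ : Setoid J)) h

lemma c_bound {C : CartanADE J} {D : DiagAut C} {c : J → J → ℤ}
    (hc : IsFoldedCartan C D.σ c) (κ x : J) : -(c κ x) ≤ orbitSize D.σ x := by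
  have h1 := hc κ x
  have hx : (1:ℚ) ≤ orbitSize D.σ x := by exact_mod_cast os_pos D.σ x
  have hκ : (1:ℚ) ≤ orbitSize D.σ κ := by exact_mod_cast os_pos D.σ κ
  have : -(c κ x : ℚ) ≤ orbitSize D.σ x := by
    rw [h1]
    split_ifs
    · linarith
    · rw [neg_neg]
      exact max_le hx (div_le_self (by linarith) hκ)
    · linarith
  exact_mod_cast this

/-- Leading-term property. -/
lemma lrootF_lead {C : CartanADE J} {D : DiagAut C} {c : J → J → ℤ}
    (hc : IsFoldedCartan C D.σ c) (x κ : J) (p z : ℤ) (hz : p + orbitSize D.σ x ≤ z) :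
    lrootF D.σ c x p (κ, z) = if SameOrbit D.σ x κ ∧ z = p + orbitSize D.σ x then 1 else 0 := by
  have hpos : (0:ℤ) < orbitSize D.σ x := by exact_mod_cast os_pos _ _
  have hb := c_bound hc κ x
  unfold lrootF varpiF
  simp only
  rw [if_neg (c := SameOrbit D.σ x κ ∧ z = p - orbitSize D.σ x) (by omega), if_neg (c := (¬ SameOrbit D.σ x κ) ∧ _)]
  · ring
  · rintro ⟨-, k, h1, h2, h3⟩
    omega

lemma indep {C : CartanADE J} {D : DiagAut C} {c : J → J → ℤ}
    (hc : IsFoldedCartan C D.σ c) (h : (J × ℤ) →₀ ℤ) (hrep : ∀ x ∈ h.support, rep D.σ x.1 = x.1)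
    (h0 : h.sum (fun x n => n • lrootF D.σ c x.1 x.2) = 0) : h = 0 := by
  by_contra hne
  have hne' : h.support.Nonempty := Finsupp.support_nonempty_iff.2 hne
  obtain ⟨x, hx, hmax⟩ := Finset.exists_max_image h.support
    (fun x => x.2 + (orbitSize D.σ x.1 : ℤ)) hne'
  have := congrFun h0 (x.1, x.2 + orbitSize D.σ x.1)
  rw [Finsupp.sum, Finset.sum_apply, Finset.sum_eq_single x] at this
  · rw [Pi.smul_apply, lrootF_lead hc _ _ _ _ le_rfl, if_pos ⟨so_refl _ _, rfl⟩] at this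
    simp at this hx
    exact hx this
  · intro x' hx' hne
    rw [Pi.smul_apply, lrootF_lead hc _ _ _ _ (hmax x' hx'), if_neg, smul_zero]
    rintro ⟨h1, h2⟩
    apply hne
    have e := rep_eq h1
    rw [hrep x hx, hrep x' hx'] at e
    refine Prod.ext e ?_
    rw [e] at h2; omega
  · intro h; exact absurd hx h

lemma closure_repr {C : CartanADE J} {D : DiagAut C} {ξ : J → ℤ} {c : J → J → ℤ}
    (hc : IsFoldedCartan C D.σ c) (X : (J × ℤ) → ℤ)
    (hX : X ∈ AddSubmonoid.closure (lrootSet D.σ ξ c)) :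
    ∃ e : (J × ℤ) →₀ ℤ, (∀ x, 0 ≤ e x) ∧ (∀ x, rep D.σ x.1 ≠ x.1 → e x = 0) ∧
      X = e.sum (fun x n => n • lrootF D.σ c x.1 x.2) := by
  induction hX using AddSubmonoid.closure_induction with
  | mem X hX =>
    obtain ⟨x, p, -, rfl⟩ := hX
    refine ⟨Finsupp.single (rep D.σ x, p) 1, ?_, ?_, ?_⟩
    · intro y
      rw [Finsupp.single_apply]; split_ifs <;> norm_num
    · intro y hy
      rw [Finsupp.single_apply, if_neg]
      rintro rfl
      exact hy (rep_eq (so_symm (rep_so D.σ x)))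
    · rw [Finsupp.sum_single_index (by simp), one_smul]
      exact lrootF_congr hc (rep_so D.σ x) p
  | zero => exact ⟨0, by simp, by simp, by simp⟩
  | add X Y _ _ hX hY =>
    obtain ⟨e, h1, h2, h3⟩ := hX
    obtain ⟨f, h1', h2', h3'⟩ := hY
    refine ⟨e + f, ?_, ?_, ?_⟩
    · intro x; exact add_nonneg (h1 x) (h1' x)
    · intro x hx; rw [Finsupp.add_apply, h2 x hx, h2' x hx, add_zero]
    · rw [Finsupp.sum_add_index' (by simp) (by intros; rw [add_smul]), h3, h3']

lemma coeff_nonneg {C : CartanADE J} {D : DiagAut C} {ξ : J → ℤ} (hξ : IsHeightFunction C D ξ)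
    {c : J → J → ℤ} (hc : IsFoldedCartan C D.σ c) {L : ℕ} (ii : Fin L → J) (G : Fin L → ℤ)
    (hX : ∑ t, G t • lrootF D.σ c (ii t) (heightAt D.σ ξ ii t - orbitSize D.σ (ii t)) ∈
      AddSubmonoid.closure (lrootSet D.σ ξ c)) (r : Fin L) : 0 ≤ G r := by
  obtain ⟨e, h1, h2, h3⟩ := closure_repr hc _ hX
  set pt : Fin L → J × ℤ := fun t => (rep D.σ (ii t), heightAt D.σ ξ ii t - orbitSize D.σ (ii t)) with hpt
  set f : (J × ℤ) →₀ ℤ := ∑ t, Finsupp.single (pt t) (G t) with hf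
  have hadd : ∀ (x : J × ℤ) (a b : ℤ), (a + b) • lrootF D.σ c x.1 x.2 =
      a • lrootF D.σ c x.1 x.2 + b • lrootF D.σ c x.1 x.2 := by intros; rw [add_smul]
  have hz : ∀ (x : J × ℤ), (0 : ℤ) • lrootF D.σ c x.1 x.2 = 0 := by simp
  have hfs : f.sum (fun x n => n • lrootF D.σ c x.1 x.2) =
      ∑ t, G t • lrootF D.σ c (ii t) (heightAt D.σ ξ ii t - orbitSize D.σ (ii t)) := by
    rw [hf, ← Finsupp.sum_finsetSum_index hz hadd]
    refine Finset.sum_congr rfl fun t _ => ?_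
    rw [Finsupp.sum_single_index (hz _)]
    rw [lrootF_congr hc (rep_so D.σ (ii t))]
  have hinj : ∀ t, pt t = pt r → t = r := by
    intro t ht
    have h1 : rep D.σ (ii t) = rep D.σ (ii r) := congrArg Prod.fst ht
    have h2 : heightAt D.σ ξ ii t - orbitSize D.σ (ii t) = heightAt D.σ ξ ii r - orbitSize D.σ (ii r) :=
      congrArg Prod.snd ht
    have hso : SameOrbit D.σ (ii t) (ii r) := by
      have := rep_so D.σ (ii t)
      rw [h1] at this
      exact so_trans this (so_symm (rep_so D.σ (ii r)))
    rw [os_congr hso] at h2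
    exact pos_distinct hξ ii t r hso (by omega)
  have hfr : f (pt r) = G r := by
    rw [hf, Finsupp.finsetSum_apply, Finset.sum_eq_single r]
    · simp
    · intro t _ hne
      rw [Finsupp.single_apply, if_neg]
      intro h; exact hne (hinj t h)
    · simp
  have hfrep : ∀ x, rep D.σ x.1 ≠ x.1 → f x = 0 := by
    intro x hx
    rw [hf, Finsupp.finsetSum_apply]
    apply Finset.sum_eq_zero
    intro t _
    rw [Finsupp.single_apply, if_neg]
    rintro rfl
    exact hx (rep_eq (so_symm (rep_so D.σ (ii t))))
  have hef : e - f = 0 := by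
    apply indep hc
    · intro x hx
      by_contra hne
      rw [Finsupp.mem_support_iff, Finsupp.sub_apply, h2 x hne, hfrep x hne] at hx
      simp at hx
    · rw [Finsupp.sum_sub_index (by intros; rw [sub_smul]), hfs, ← h3, sub_self]
  have := h1 (pt r)
  rw [sub_eq_zero.1 hef, hfr] at this
  exact this

lemma varpi_indep {C : CartanADE J} {D : DiagAut C} {ξ : J → ℤ} (hξ : IsHeightFunction C D ξ)
    {L : ℕ} (ii : Fin L → J) (d : Fin L → ℤ)
    (h : ∑ t, d t • varpiF D.σ (ii t) (heightAt D.σ ξ ii t) = 0) (r : Fin L) : d r = 0 := by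
  have := congrFun h (ii r, heightAt D.σ ξ ii r)
  rw [Finset.sum_apply, Finset.sum_eq_single r] at this
  · simpa [varpiF, so_refl] using this
  · intro t _ hne
    rw [Pi.smul_apply, varpiF, if_neg, smul_zero]
    rintro ⟨h1, h2⟩
    exact hne (pos_distinct hξ ii t r h1 h2.symm)
  · simp

end Independence

/-- Proposition 6.8: `Ω_Q` restricts to an isomorphism of posets
`(KP(β), ≼_𝐢) ≃ (𝒫⁺_{Q,β}, ≤)`. -/
theorem statement14 (C : CartanADE J) (D : DiagAut C) (ξ : J → ℤ)
    (hξ : IsHeightFunction C D ξ)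
    (c : J → J → ℤ) (hc : IsFoldedCartan C D.σ c)
    (L : ℕ) (ii : Fin L → J) (hr : IsReducedWord C ii) (ha : IsAdapted C D ξ ii)
    (Λ : J → J → ℚ) (hΛ : IsFundWeights C Λ)
    (β : J → ℤ) (hβ : ∀ ι : J, 0 ≤ β ι) :
    Set.InjOn (OmegaQmap C D.σ ξ ii) {m | IsKP C β m} ∧
    (∀ m n : (J → ℤ) → ℤ, IsKP C β m → IsKP C β n →
      (kpLE C ii Λ m n ↔
        OmegaQmap C D.σ ξ ii n - OmegaQmap C D.σ ξ ii m ∈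
          AddSubmonoid.closure (lrootSet D.σ ξ c))) := by
  have hdiff : ∀ m n : (J → ℤ) → ℤ, OmegaQmap C D.σ ξ ii n - OmegaQmap C D.σ ξ ii m =
      ∑ t, (n (betaOf C ii t) - m (betaOf C ii t)) • varpiF D.σ (ii t) (heightAt D.σ ξ ii t) := by
    intro m n
    simp only [OmegaQmap, sub_smul, Finset.sum_sub_distrib]
  constructor
  · intro m hm n hn he
    have h0 := hdiff m n
    rw [he, sub_self] at h0
    have hz := varpi_indep hξ ii _ h0.symm
    funext v
    by_cases hv : v ∈ posRoots C
    · rw [← beta_image hΛ hr] at hv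
      obtain ⟨t, rfl⟩ := hv
      have := hz t
      omega
    · rw [hm.1 v hv, hn.1 v hv]
  · intro m n hm hn
    have hsum : ∑ t, (n (betaOf C ii t) - m (betaOf C ii t)) • betaOf C ii t = 0 := by
      simp only [sub_smul, Finset.sum_sub_distrib]
      rw [kp_sum hΛ hr hm, kp_sum hΛ hr hn, sub_self]
    have hL := gg_final C ii (fun t => n (betaOf C ii t) - m (betaOf C ii t)) hsum
    have hG : ∀ r : Fin L, rhoOf C ii Λ m r ≤ rhoOf C ii Λ n r ↔
        0 ≤ gg C ii (fun t => n (betaOf C ii t) - m (betaOf C ii t)) (r.1 + 1) (ii r) := by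
      intro r
      rw [rho_eq hΛ, rho_eq hΛ, gg_sub C ii _ _ _ r.2, Pi.sub_apply, sub_nonneg, Int.cast_le]
    rw [hdiff, final_identity hξ hc ha _ hL]
    constructor
    · intro hle
      refine AddSubmonoid.sum_mem _ fun t _ => ?_
      obtain ⟨N, hN⟩ := Int.eq_ofNat_of_zero_le ((hG t).1 (hle t))
      rw [hN, natCast_zsmul]
      have hmem : lrootF D.σ c (ii t) (heightAt D.σ ξ ii t - orbitSize D.σ (ii t)) ∈
          lrootSet D.σ ξ c := by
        refine ⟨ii t, _, ?_, rfl⟩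
        obtain ⟨e, he⟩ := HH_cong D.σ ξ ii t.1 t.2.le (ii t)
        refine ⟨orbitSize D.σ (ii t) * e, ?_⟩
        have he' : heightAt D.σ ξ ii t - ξ (ii t) = 2 * (orbitSize D.σ (ii t) : ℤ) * e := he
        linear_combination he'
      exact AddSubmonoid.nsmul_mem _ (AddSubmonoid.subset_closure hmem) N
    · intro hX r
      exact (hG r).2 (coeff_nonneg hξ hc ii _ hX r)

end QDatumPaper
end

section
/- Let Q = (J,σ,ξ) be a Q-datum. Then the family of ℓ-roots {α_{i,p} : (i,p+𝗌_i) ∈ Î₀} is linearly independent over ℤ in 𝒫_ℤ; equivalently, the subgroup 𝒬_ℤ of 𝒫_ℤ generated by the ℓ-roots is a free abelian group with basis the ℓ-roots. -/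
open scoped BigOperators Classical

namespace QDatumPaper

variable {J : Type} [Fintype J] [DecidableEq J]

lemma orbitSize_pos' (σ : Equiv.Perm J) (ι : J) : 0 < orbitSize σ ι := by
  unfold orbitSize
  rw [Finset.card_pos]
  exact ⟨ι, Finset.mem_image.2 ⟨0, Finset.mem_range.2 (orderOf_pos σ), by simp⟩⟩

lemma orbitSize_eq_of_same (σ : Equiv.Perm J) {ι j : J} (h : SameOrbit σ ι j) :
    orbitSize σ ι = orbitSize σ j := by
  obtain ⟨k, rfl⟩ := h
  unfold orbitSize
  have : ((Finset.range (orderOf σ)).image fun m => (σ ^ m) ((σ ^ k) ι)) =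
      ((Finset.range (orderOf σ)).image fun m => (σ ^ m) ι).image (σ ^ k) := by
    rw [Finset.image_image]
    congr 1
    funext m
    simp only [Function.comp, ← Equiv.Perm.mul_apply, ← pow_add, add_comm]
  rw [this, Finset.card_image_of_injective _ (σ ^ k).injective]

lemma neg_c_le (C : CartanADE J) (σ : Equiv.Perm J) (c : J → J → ℤ)
    (hc : IsFoldedCartan C σ c) (ι j : J) : - c ι j ≤ (orbitSize σ j : ℤ) := by
  have h := hc ι j
  have hj : (1 : ℚ) ≤ orbitSize σ j := by exact_mod_cast orbitSize_pos' σ j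
  have hi : (1 : ℚ) ≤ orbitSize σ ι := by exact_mod_cast orbitSize_pos' σ ι
  have : (-(c ι j : ℚ)) ≤ orbitSize σ j := by
    rw [h]
    split_ifs
    · linarith
    · rw [neg_neg]
      exact max_le hj (div_le_self (by linarith) hi)
    · linarith
  exact_mod_cast this

lemma lrootF_top (C : CartanADE J) (σ : Equiv.Perm J) (c : J → J → ℤ)
    (hc : IsFoldedCartan C σ c) (ι : J) (p : ℤ) (j : J) (q : ℤ)
    (hq : p + (orbitSize σ ι : ℤ) ≤ q) :
    lrootF σ c ι p (j, q) = if SameOrbit σ ι j ∧ q = p + (orbitSize σ ι : ℤ) then 1 else 0 := by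
  have hpos := orbitSize_pos' σ ι
  have hle := neg_c_le C σ c hc j ι
  unfold lrootF varpiF
  have h2 : ¬ (SameOrbit σ ι j ∧ q = p - (orbitSize σ ι : ℤ)) := by
    rintro ⟨_, h⟩
    omega
  have h3 : ¬ ((¬ SameOrbit σ ι j) ∧
      ∃ k : ℤ, 1 ≤ k ∧ k ≤ -(c j ι) ∧ q = p - c j ι + 1 - 2 * k) := by
    rintro ⟨_, k, h1, _, h⟩
    omega
  simp only [if_neg h2, if_neg h3, add_zero, sub_zero]

/-- the ℓ-roots `α_{i,p}` (with `(i, p+𝗌_i) ∈ Î₀`) are linearly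
independent over ℤ in `𝒫_ℤ`: any ℤ-linear combination of pairwise distinct ℓ-roots
vanishing must have all coefficients zero. -/
theorem statement16 (C : CartanADE J) (D : DiagAut C) (ξ : J → ℤ)
    (hξ : IsHeightFunction C D ξ)
    (c : J → J → ℤ) (hc : IsFoldedCartan C D.σ c) :
    ∀ (S : Finset (J × ℤ)) (coef : J × ℤ → ℤ),
      (∀ x ∈ S, ValidLRootIdx D.σ ξ x.1 x.2) →
      (∀ x ∈ S, ∀ y ∈ S, SameOrbit D.σ x.1 y.1 → x.2 = y.2 → x = y) →
      (∑ x ∈ S, coef x • lrootF D.σ c x.1 x.2) = 0 →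
      ∀ x ∈ S, coef x = 0 := by
  intro S coef _ hinj hsum
  by_contra! hne
  obtain ⟨x0, hx0, hx0c⟩ := hne
  obtain ⟨x, hx, hmax⟩ := Finset.exists_max_image (S.filter fun x => coef x ≠ 0)
    (fun x => x.2 + (orbitSize D.σ x.1 : ℤ)) ⟨x0, Finset.mem_filter.2 ⟨hx0, hx0c⟩⟩
  obtain ⟨hxS, hxc⟩ := Finset.mem_filter.1 hx
  have h := congrFun hsum (x.1, x.2 + (orbitSize D.σ x.1 : ℤ))
  rw [Finset.sum_apply, Finset.sum_eq_single_of_mem x hxS] at h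
  · rw [Pi.smul_apply, lrootF_top C D.σ c hc _ _ _ _ le_rfl,
      if_pos ⟨⟨0, by simp⟩, rfl⟩] at h
    exact hxc (by simpa using h)
  · intro y hy hyx
    by_cases hyc : coef y = 0
    · simp [hyc]
    · rw [Pi.smul_apply, lrootF_top C D.σ c hc _ _ _ _
        (hmax y (Finset.mem_filter.2 ⟨hy, hyc⟩)), if_neg, smul_zero]
      rintro ⟨hs, he⟩
      have := orbitSize_eq_of_same D.σ hs
      exact hyx (hinj y hy x hxS hs (by rw [this] at he; omega))

end QDatumPaper
end
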